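/- arXiv:1808.05940 — 4 statements merged into one kernel-verified Lean document; each statement's English description precedes it below -/
import Mathlib

section
/- If G ∈ F, then the minimum degree of G is at least 3. -/
open SimpleGraph

/-- The complete graph on five vertices. -/
def K5 : SimpleGraph (Fin 5) := ⊤

/-- The complete bipartite graph `K_{3,3}`. -/
def K33 : SimpleGraph (Fin 6) :=
  SimpleGraph.fromRel (fun i j => i.val < 3 ∧ 3 ≤ j.val)

/-- `K_{3,3}` plus one extra edge joining two vertices in the same part. -/
def K33e : SimpleGraph (Fin 6) :=
  SimpleGraph.fromRel (fun i j => (i.val < 3 ∧ 3 ≤ j.val) ∨ (i.val = 0 ∧ j.val = 1))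

/-- `H` is a minor of `G`, witnessed by a family of nonempty, connected,
pairwise disjoint branch sets together with edges between the branch sets of
adjacent vertices of `H`. -/
def SimpleGraph.IsMinorOf {W V : Type} (H : SimpleGraph W) (G : SimpleGraph V) : Prop :=
  ∃ f : W → Set V,
    (∀ w, (G.induce (f w)).Connected) ∧
    (Pairwise fun w w' => Disjoint (f w) (f w')) ∧
    (∀ ⦃w w'⦄, H.Adj w w' → ∃ u ∈ f w, ∃ v ∈ f w', G.Adj u v)

/-- Planarity, via the Kuratowski–Wagner characterization: a (finite simple) graph is
planar iff it has no `K₅` minor and no `K_{3,3}` minor. -/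
def IsPlanar {V : Type} (G : SimpleGraph V) : Prop :=
  ¬ K5.IsMinorOf G ∧ ¬ K33.IsMinorOf G

/-- A graph is apex if it is planar or some vertex deletion makes it planar. -/
def IsApex {V : Type} (G : SimpleGraph V) : Prop :=
  IsPlanar G ∨ ∃ v : V, IsPlanar (G.induce {u | u ≠ v})

/-- `G` is an obstruction for the apex family: it is not apex, but every minor of it
that is not isomorphic to it is apex. -/
def IsApexObstruction {V : Type} (G : SimpleGraph V) : Prop :=
  ¬ IsApex G ∧
    ∀ (W : Type) (H : SimpleGraph W), H.IsMinorOf G → IsEmpty (H ≃g G) → IsApex H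

/-- Subdivide the edge `uv` of `G`: the new vertex is `none`. -/
def subdivideEdge {V : Type} (G : SimpleGraph V) (u v : V) : SimpleGraph (Option V) :=
  SimpleGraph.fromRel (fun x y =>
    (∃ a b, x = some a ∧ y = some b ∧ G.Adj a b ∧ s(a, b) ≠ s(u, v)) ∨
    (x = none ∧ (y = some u ∨ y = some v)))

/-- `IsSubdivision G H` : `H` is (isomorphic to) a graph obtained from `G` by repeatedly
subdividing edges. -/
inductive IsSubdivision : {V : Type} → SimpleGraph V → {W : Type} → SimpleGraph W → Prop
  | of_iso {V W : Type} {G : SimpleGraph V} {H : SimpleGraph W} :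
      (G ≃g H) → IsSubdivision G H
  | step {V W U : Type} {G : SimpleGraph V} {H : SimpleGraph W} {u v : W}
      {H' : SimpleGraph U} :
      H.Adj u v → IsSubdivision G H → (subdivideEdge H u v ≃g H') → IsSubdivision G H'

/-- A Kuratowski subgraph of `G` is a subgraph that is a subdivision of `K₅` or `K_{3,3}`. -/
def IsKuratowski {V : Type} {G : SimpleGraph V} (H : G.Subgraph) : Prop :=
  IsSubdivision K5 H.coe ∨ IsSubdivision K33 H.coe

/-- A Kuratowski witness for `v` is a Kuratowski subgraph of `G` avoiding `v`. -/
def IsKuratowskiWitness {V : Type} (G : SimpleGraph V) (v : V) (H : G.Subgraph) : Prop :=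
  IsKuratowski H ∧ v ∉ H.verts

/-- A branch vertex of a (Kuratowski) subgraph: a vertex of degree at least 3 in it. -/
def IsBranchVertex {V : Type} {G : SimpleGraph V} (H : G.Subgraph) (x : V) : Prop :=
  x ∈ H.verts ∧ 3 ≤ (H.neighborSet x).ncard

/-- The vertex connectivity of a finite graph: the largest `k` such that deleting any
fewer than `k` vertices leaves a connected graph. -/
noncomputable def vConn {V : Type} [Fintype V] (G : SimpleGraph V) : ℕ :=
  sSup {k : ℕ | ∀ s : Finset V, s.card < k → (G.induce ((↑s : Set V)ᶜ)).Connected}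

/-- A 2-cut: a set of two vertices whose deletion disconnects the graph. -/
def IsTwoCut {V : Type} (G : SimpleGraph V) (S : Set V) : Prop :=
  S.ncard = 2 ∧ ¬ (G.induce Sᶜ).Preconnected

/-- `C` is (the vertex set of) a connected component of `G − S`. -/
def IsCompOf {V : Type} (G : SimpleGraph V) (S : Set V) (C : Set V) : Prop :=
  C.Nonempty ∧ Disjoint C S ∧ (G.induce C).Connected ∧
    ∀ u ∈ C, ∀ v, v ∉ S → G.Adj u v → v ∈ C

/-- The augmented component `C⁺`: the subgraph induced by `C ∪ S` together with all
edges joining vertices of `S`. -/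
def augment {V : Type} (G : SimpleGraph V) (S C : Set V) : SimpleGraph ↥(C ∪ S) :=
  SimpleGraph.fromRel (fun u v => G.Adj (u : V) (v : V) ∨ ((u : V) ∈ S ∧ (v : V) ∈ S))

/-- `C` is a heavy component for the 2-cut `{a,b}`: a component of `G − {a,b}` whose
augmentation contains Kuratowski witnesses for both `a` and `b`. -/
def IsHeavyComp {V : Type} (G : SimpleGraph V) (a b : V) (C : Set V) : Prop :=
  IsCompOf G {a, b} C ∧
    (∃ Ha : G.Subgraph, IsKuratowskiWitness G a Ha ∧ Ha.verts ⊆ C ∪ {a, b}) ∧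
    (∃ Hb : G.Subgraph, IsKuratowskiWitness G b Hb ∧ Hb.verts ⊆ C ∪ {a, b})

/-- `{a,b}` is a basic 2-cut with heavy component `C`: a 2-cut whose heavy-component
weight is minimum among all 2-cuts. -/
def IsBasic2Cut {V : Type} (G : SimpleGraph V) (a b : V) (C : Set V) : Prop :=
  IsTwoCut G {a, b} ∧ IsHeavyComp G a b C ∧
    ∀ c d : V, ∀ D : Set V, IsTwoCut G {c, d} → IsHeavyComp G c d D → C.ncard ≤ D.ncard

/-- The subgraph of `G` induced by `A`, kept on the same vertex set (vertices outside `A`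
become isolated). -/
def restrictTo {V : Type} (G : SimpleGraph V) (A : Set V) : SimpleGraph V :=
  SimpleGraph.fromRel (fun u v => G.Adj u v ∧ u ∈ A ∧ v ∈ A)

/-- Contract the edge `uv` of `G`, keeping the label `u` for the merged vertex
(`v` becomes isolated). -/
def contractEdge {V : Type} (G : SimpleGraph V) (u v : V) : SimpleGraph V :=
  SimpleGraph.fromRel (fun x y =>
    x ≠ v ∧ y ≠ v ∧ (G.Adj x y ∨ (x = u ∧ G.Adj v y) ∨ (y = u ∧ G.Adj x v)))

/-- `T` separates `a` from `b` in `G`: `a, b ∉ T` and every walk from `a` to `b`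
meets `T`. -/
def Separates {V : Type} (G : SimpleGraph V) (T : Set V) (a b : V) : Prop :=
  a ∉ T ∧ b ∉ T ∧ ∀ p : G.Walk a b, ∃ t ∈ T, t ∈ p.support

/-- Disjoint union of two graphs. -/
def disjUnion {V W : Type} (G : SimpleGraph V) (H : SimpleGraph W) : SimpleGraph (V ⊕ W) :=
  SimpleGraph.fromRel (fun x y =>
    (∃ a b, x = Sum.inl a ∧ y = Sum.inl b ∧ G.Adj a b) ∨
    (∃ a b, x = Sum.inr a ∧ y = Sum.inr b ∧ H.Adj a b))

/-- The graph on `Fin n` with the given list of edges. -/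
def graphOfList (n : ℕ) (l : List (ℕ × ℕ)) : SimpleGraph (Fin n) :=
  SimpleGraph.fromRel (fun i j => ((i : ℕ), (j : ℕ)) ∈ l)

/-- A graph is 2-connected: at least three vertices and no cut vertex. -/
def IsTwoConnectedGraph {U : Type} (H : SimpleGraph U) : Prop :=
  3 ≤ Nat.card U ∧ ∀ u : U, (H.induce {x | x ≠ u}).Connected


theorem SimpleGraph.Connected.of_surjective {V W : Type*} {G : SimpleGraph V} {H : SimpleGraph W}
    (hG : G.Connected) (φ : V → W) (hφ : Function.Surjective φ)
    (hadj : ∀ x y, G.Adj x y → φ x = φ y ∨ H.Adj (φ x) (φ y)) : H.Connected := by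
  have key : ∀ x y, G.Reachable x y → H.Reachable (φ x) (φ y) := by
    rintro x y ⟨p⟩
    induction p with
    | nil => exact Reachable.refl _
    | cons h _ ih =>
      rcases hadj _ _ h with h | h
      · rwa [h]
      · exact h.reachable.trans ih
  have := hG.nonempty.map φ
  refine ⟨fun a b => ?_⟩
  obtain ⟨x, rfl⟩ := hφ a
  obtain ⟨y, rfl⟩ := hφ b
  exact key x y (hG.preconnected x y)

theorem SimpleGraph.IsMinorOf.of_injective_hom {W U V : Type} {K : SimpleGraph W}
    {G : SimpleGraph U} {G' : SimpleGraph V} (h : K.IsMinorOf G) (φ : G →g G')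
    (hφ : Function.Injective φ) : K.IsMinorOf G' := by
  obtain ⟨f, hc, hd, ha⟩ := h
  refine ⟨fun w => φ '' f w, fun w => ?_, fun w w' hw => ?_, fun w w' hw => ?_⟩
  · refine (hc w).of_surjective (fun x => ⟨φ x, x, x.2, rfl⟩) ?_ fun x y hxy => .inr (φ.map_adj hxy)
    rintro ⟨_, x, hx, rfl⟩
    exact ⟨⟨x, hx⟩, rfl⟩
  · exact (Set.disjoint_image_iff hφ).2 (hd hw)
  · obtain ⟨u, hu, v, hv, huv⟩ := ha hw
    exact ⟨_, ⟨u, hu, rfl⟩, _, ⟨v, hv, rfl⟩, φ.map_adj huv⟩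

theorem IsPlanar.of_injective_hom {U V : Type} {G : SimpleGraph U} {G' : SimpleGraph V}
    (h : IsPlanar G') (φ : G →g G') (hφ : Function.Injective φ) : IsPlanar G :=
  ⟨fun hm => h.1 (hm.of_injective_hom φ hφ), fun hm => h.2 (hm.of_injective_hom φ hφ)⟩

/-- Delete `v` and make its neighbours pairwise adjacent. For a vertex of degree two this
suppresses `v`, and for a vertex of degree at most one it deletes `v`. -/
def suppress {V : Type} (G : SimpleGraph V) (v : V) : SimpleGraph {u | u ≠ v} where
  Adj x y := x ≠ y ∧ (G.Adj x y ∨ G.Adj v x ∧ G.Adj v y)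
  symm := ⟨fun _ _ h => ⟨h.1.symm, h.2.imp (fun h => h.symm) And.symm⟩⟩
  loopless := ⟨fun _ h => h.1 rfl⟩

/-- The vertex `v` does not have three distinct neighbours. -/
def DegreeLeTwo {V : Type} (G : SimpleGraph V) (v : V) : Prop :=
  ∀ a b c, G.Adj v a → G.Adj v b → G.Adj v c → a = b ∨ a = c ∨ b = c

theorem suppress_isMinorOf {V : Type} {G : SimpleGraph V} {v : V} (hv : DegreeLeTwo G v) :
    (suppress G v).IsMinorOf G := by
  by_cases hN : ∃ a, G.Adj v a
  · obtain ⟨a, hva⟩ := hN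
    refine ⟨fun x => {u | u = x ∨ u = v ∧ (x : V) = a}, fun x => ?_, fun x y hxy => ?_,
      fun x y hxy => ?_⟩
    · have hr : ∀ u (hu : u ∈ {u | u = (x : V) ∨ u = v ∧ (x : V) = a}),
          (G.induce {u | u = (x : V) ∨ u = v ∧ (x : V) = a}).Reachable ⟨x, .inl rfl⟩ ⟨u, hu⟩ := by
        intro u hu
        rcases id hu with rfl | ⟨rfl, hx⟩
        · exact Reachable.refl _
        · refine Adj.reachable ?_
          simpa [hx] using hva.symm
      have : Nonempty ↥{u | u = (x : V) ∨ u = v ∧ (x : V) = a} := ⟨⟨x, .inl rfl⟩⟩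
      exact ⟨fun y z => (hr y y.2).symm.trans (hr z z.2)⟩
    · refine Set.disjoint_left.2 ?_
      rintro u (hu | ⟨hu, hx⟩) (hu' | ⟨hu', hy⟩)
      · exact hxy (Subtype.ext (hu.symm.trans hu'))
      · exact x.2 (hu.symm.trans hu')
      · exact y.2 (hu'.symm.trans hu)
      · exact hxy (Subtype.ext (hx.trans hy.symm))
    · obtain ⟨hne, h | ⟨hx, hy⟩⟩ := hxy
      · exact ⟨x, .inl rfl, y, .inl rfl, h⟩
      · rcases hv a x y hva hx hy with h | h | h
        · exact ⟨v, .inr ⟨rfl, h.symm⟩, y, .inl rfl, hy⟩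
        · exact ⟨x, .inl rfl, v, .inr ⟨rfl, h.symm⟩, hx.symm⟩
        · exact absurd (Subtype.ext h) hne
  · have hN' : ∀ a, ¬ G.Adj v a := fun a h => hN ⟨a, h⟩
    refine ⟨fun x => {(x : V)}, fun x => ?_, fun x y hxy => ?_, fun x y hxy => ?_⟩
    · have : Nonempty ↥({(x : V)} : Set V) := ⟨⟨x, rfl⟩⟩
      exact ⟨fun y z => by rw [Subsingleton.elim y z]⟩
    · simpa [Subtype.ext_iff] using hxy
    · exact ⟨x, rfl, y, rfl, hxy.2.resolve_right fun h => hN' _ h.1⟩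

theorem SimpleGraph.IsMinorOf.suppress {W V : Type} {K : SimpleGraph W} {G : SimpleGraph V} {v : V}
    (h : K.IsMinorOf G) (hv : DegreeLeTwo G v) (hK : ∀ w, ¬ DegreeLeTwo K w) :
    K.IsMinorOf (suppress G v) := by
  classical
  obtain ⟨f, hc, hd, ha⟩ := h
  have hdisj : ∀ {w w' u}, u ∈ f w → u ∈ f w' → w = w' := fun {w w' u} hu hu' => by
    by_contra hne
    exact Set.disjoint_left.1 (hd hne) hu hu'
  have hp : ∀ w, ∃ p ∈ f w, p ≠ v ∧ (v ∈ f w → G.Adj v p) := by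
    intro w
    by_cases hvw : v ∈ f w
    · by_cases hq : ∃ q ∈ f w, q ≠ v
      · obtain ⟨q, hq, hqv⟩ := hq
        obtain ⟨p⟩ := (hc w).preconnected ⟨v, hvw⟩ ⟨q, hq⟩
        cases p with
        | nil => exact absurd rfl hqv
        | @cons _ x _ hx _ =>
          have hx : G.Adj v x := hx
          exact ⟨x, x.2, hx.ne', fun _ => hx⟩
      · push Not at hq
        exfalso
        refine hK w fun a b c hwa hwb hwc => ?_
        have hnb : ∀ {x}, K.Adj w x → ∃ y ∈ f x, G.Adj v y := fun hwx => by
          obtain ⟨u, hu, y, hy, huy⟩ := ha hwx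
          exact ⟨y, hy, hq u hu ▸ huy⟩
        obtain ⟨x, hx, hvx⟩ := hnb hwa
        obtain ⟨y, hy, hvy⟩ := hnb hwb
        obtain ⟨z, hz, hvz⟩ := hnb hwc
        rcases hv x y z hvx hvy hvz with rfl | rfl | rfl
        · exact .inl (hdisj hx hy)
        · exact .inr (.inl (hdisj hx hz))
        · exact .inr (.inr (hdisj hy hz))
    · obtain ⟨p, hp⟩ := (hc w).nonempty
      exact ⟨p, hp, fun h => hvw (h ▸ hp), fun h => absurd h hvw⟩
  choose p hpf hpv hpa using hp
  refine ⟨fun w => {x | (x : V) ∈ f w}, fun w => ?_, fun w w' hw => ?_, fun w w' hw => ?_⟩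
  · refine (hc w).of_surjective
      (fun x => if hx : (x : V) = v then ⟨⟨p w, hpv w⟩, hpf w⟩ else ⟨⟨x, hx⟩, x.2⟩) ?_ ?_
    · rintro ⟨⟨x, hxv⟩, hx⟩
      exact ⟨⟨x, hx⟩, dif_neg hxv⟩
    · rintro ⟨x, hx⟩ ⟨y, hy⟩ hxy
      have hxy : G.Adj x y := hxy
      rw [or_iff_not_imp_left]
      intro hne
      refine ⟨fun h => hne (Subtype.ext h), ?_⟩
      by_cases hxv : x = v <;> by_cases hyv : y = v
      · exact absurd (hxv.trans hyv.symm) hxy.ne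
      · subst hxv
        simpa [hyv] using Or.inr ⟨hpa w hx, hxy⟩
      · subst hyv
        simpa [hxv] using Or.inr ⟨hxy.symm, hpa w hy⟩
      · simpa [hxv, hyv] using Or.inl hxy
  · exact Set.disjoint_left.2 fun _ hx hy => hw (hdisj hx hy)
  · obtain ⟨u, hu, u', hu', huu⟩ := ha hw
    by_cases huv : u = v
    · subst huv
      refine ⟨⟨p w, hpv w⟩, hpf w, ⟨u', huu.ne'⟩, hu', fun h => ?_, .inr ⟨hpa w hu, huu⟩⟩
      have h : p w = u' := congrArg Subtype.val h
      exact hw.ne (hdisj (hpf w) (h ▸ hu'))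
    · by_cases huv' : u' = v
      · subst huv'
        refine ⟨⟨u, huv⟩, hu, ⟨p w', hpv w'⟩, hpf w', fun h => ?_, .inr ⟨huu.symm, hpa w' hu'⟩⟩
        have h : u = p w' := congrArg Subtype.val h
        exact hw.ne (hdisj (h ▸ hu) (hpf w'))
      · exact ⟨⟨u, huv⟩, hu, ⟨u', huv'⟩, hu', fun h => huu.ne (congrArg Subtype.val h), .inl huu⟩

theorem not_degreeLeTwo_K5 (w : Fin 5) : ¬ DegreeLeTwo K5 w := by
  unfold DegreeLeTwo K5
  simp only [top_adj]
  revert w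
  decide

theorem not_degreeLeTwo_K33 (w : Fin 6) : ¬ DegreeLeTwo K33 w := by
  unfold DegreeLeTwo K33
  simp only [fromRel_adj]
  revert w
  decide

theorem IsPlanar.of_suppress {V : Type} {G : SimpleGraph V} {v : V} (hv : DegreeLeTwo G v)
    (h : IsPlanar (suppress G v)) : IsPlanar G :=
  ⟨fun hm => h.1 (hm.suppress hv not_degreeLeTwo_K5),
    fun hm => h.2 (hm.suppress hv not_degreeLeTwo_K33)⟩

theorem DegreeLeTwo.induce {V : Type} {G : SimpleGraph V} {s : Set V} {v : s}
    (hv : DegreeLeTwo G v) : DegreeLeTwo (G.induce s) v := by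
  intro a b c ha hb hc
  simpa only [Subtype.ext_iff] using hv a b c ha hb hc

theorem IsApex.of_suppress {V : Type} {G : SimpleGraph V} {v : V} (hv : DegreeLeTwo G v)
    (h : IsApex (suppress G v)) : IsApex G := by
  rcases h with h | ⟨⟨w, hw⟩, h⟩
  · exact .inl (h.of_suppress hv)
  · have hvw : v ∈ {u | u ≠ w} := Ne.symm hw
    refine .inr ⟨w, IsPlanar.of_suppress (v := ⟨v, hvw⟩) hv.induce ?_⟩
    refine h.of_injective_hom
      ⟨fun x => ⟨⟨x, fun h => x.2 (Subtype.ext h)⟩, fun h => x.1.2 (congrArg Subtype.val h)⟩,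
        fun {x y} hxy => ?_⟩ fun x y hxy => ?_
    · refine ⟨fun h => hxy.1 (Subtype.ext (Subtype.ext ?_)), hxy.2⟩
      exact congrArg (fun z : {u | u ≠ v} => (z : V)) h
    · exact Subtype.ext (Subtype.ext (congrArg (fun z => (z.1.1 : V)) hxy))

theorem isEmpty_suppress_iso {V : Type} [Finite V] (G : SimpleGraph V) (v : V) :
    IsEmpty (suppress G v ≃g G) := by
  refine ⟨fun e => ?_⟩
  have hinj : Function.Injective fun x => (e.symm x : V) :=
    Subtype.val_injective.comp e.symm.injective
  obtain ⟨x, hx⟩ := Finite.surjective_of_injective hinj v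
  exact (e.symm x).2 hx

/-- Every apex obstruction has minimum degree at least `3`. -/
theorem apexObstruction_min_degree {V : Type} [Fintype V] (G : SimpleGraph V)
    (hG : IsApexObstruction G) : ∀ v : V, 3 ≤ (G.neighborSet v).ncard := by
  intro v
  by_contra hlt
  have hv : DegreeLeTwo G v := by
    intro a b c ha hb hc
    by_contra! hne
    exact hlt ((Set.two_lt_ncard_iff (Set.toFinite _)).2
      ⟨a, b, c, ha, hb, hc, hne.1, hne.2.1, hne.2.2⟩)
  exact hG.1 ((hG.2 _ _ (suppress_isMinorOf hv) (isEmpty_suppress_iso G v)).of_suppress hv)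
end

section
/- The disconnected graphs in F are exactly 2K_5 (the disjoint union of two copies of K_5), 2K_{3,3} (the disjoint union of two copies of K_{3,3}), and K_5 + K_{3,3} (the disjoint union of K_5 and K_{3,3}). -/
open SimpleGraph

namespace SimpleGraph

/-- `f` is a family of branch sets exhibiting `H` as a minor of `G`. -/
def IsMinorModel {W V : Type} (H : SimpleGraph W) (G : SimpleGraph V) (f : W → Set V) : Prop :=
  (∀ w, (G.induce (f w)).Connected) ∧
    (Pairwise fun w w' => Disjoint (f w) (f w')) ∧
    (∀ ⦃w w'⦄, H.Adj w w' → ∃ u ∈ f w, ∃ v ∈ f w', G.Adj u v)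

/-- `S` is a union of connected components of `G`: no edge leaves `S`. -/
def IsEdgeClosed {V : Type} (G : SimpleGraph V) (S : Set V) : Prop :=
  ∀ ⦃u v⦄, G.Adj u v → (u ∈ S ↔ v ∈ S)

variable {U V W : Type} {X : SimpleGraph U} {G : SimpleGraph V} {H : SimpleGraph W}

lemma IsEdgeClosed.compl {S : Set V} (hS : G.IsEdgeClosed S) : G.IsEdgeClosed Sᶜ :=
  fun _ _ h => not_congr (hS h)

lemma IsEdgeClosed.mem_iff {S : Set V} (hS : G.IsEdgeClosed S) {u v : V}
    (h : G.Reachable u v) : u ∈ S ↔ v ∈ S := by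
  obtain ⟨p⟩ := h
  induction p with
  | nil => rfl
  | cons huv _ ih => exact (hS huv).trans ih

lemma connected_induce_image_iff (e : H ↪g G) (s : Set W) :
    (G.induce (e '' s)).Connected ↔ (H.induce s).Connected :=
  (Iso.connected_iff
    (⟨Equiv.Set.image e s e.injective, e.map_adj_iff⟩ : H.induce s ≃g G.induce (e '' s))).symm

lemma connected_induce_singleton (v : V) : (G.induce {v}).Connected := by
  rw [induce_singleton_eq_top]
  exact connected_top

lemma isMinorModel_of_embedding (e : H ↪g G) : H.IsMinorModel G fun w => {e w} :=
  ⟨fun _ => connected_induce_singleton _,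
    fun _ _ h => Set.disjoint_singleton.2 (e.injective.ne h),
    fun _ _ h => ⟨_, rfl, _, rfl, e.map_adj_iff.2 h⟩⟩

lemma IsMinorOf.of_embedding (e : H ↪g G) : H.IsMinorOf G := ⟨_, isMinorModel_of_embedding e⟩

lemma IsMinorModel.nonempty {f : W → Set V} (hf : H.IsMinorModel G f) (w : W) :
    (f w).Nonempty :=
  Set.nonempty_coe_sort.1 (hf.1 w).nonempty

lemma IsMinorModel.reachable_of_mem {f : W → Set V} (hf : H.IsMinorModel G f) {w : W} {u v : V}
    (hu : u ∈ f w) (hv : v ∈ f w) : G.Reachable u v :=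
  ((hf.1 w).preconnected ⟨u, hu⟩ ⟨v, hv⟩).map (Embedding.induce _).toHom

lemma IsMinorModel.connected_biUnion {f : W → Set V} (hf : H.IsMinorModel G f) {s : Set W}
    (hs : (H.induce s).Connected) : (G.induce (⋃ w ∈ s, f w)).Connected := by
  have key : ∀ {a b : s}, (H.induce s).Reachable a b → ∀ u v (hu : u ∈ f a) (hv : v ∈ f b),
      (G.induce (⋃ w ∈ s, f w)).Reachable
        ⟨u, Set.mem_biUnion a.2 hu⟩ ⟨v, Set.mem_biUnion b.2 hv⟩ := by
    intro a b hab
    have base : ∀ (a : s) u v (hu : u ∈ f a) (hv : v ∈ f a),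
        (G.induce (⋃ w ∈ s, f w)).Reachable
          ⟨u, Set.mem_biUnion a.2 hu⟩ ⟨v, Set.mem_biUnion a.2 hv⟩ := fun a u v hu hv =>
      ((hf.1 a).preconnected ⟨u, hu⟩ ⟨v, hv⟩).map
        (G.induceHomOfLE (Set.subset_biUnion_of_mem a.2)).toHom
    obtain ⟨p⟩ := hab
    induction p with
    | nil => exact base _
    | @cons a c b hac _ ih =>
      intro u v hu hv
      obtain ⟨x, hx, y, hy, hxy⟩ := hf.2.2 (induce_adj.1 hac)
      exact (base a u x hu hx).trans <| (Adj.reachable (by exact hxy)).trans (ih y v hy hv)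
  obtain ⟨w⟩ := hs.nonempty
  obtain ⟨v, hv⟩ := hf.nonempty w
  refine (connected_iff _).2 ⟨?_, ⟨⟨v, Set.mem_biUnion w.2 hv⟩⟩⟩
  rintro ⟨u, hu⟩ ⟨v, hv⟩
  obtain ⟨a, ha, hu⟩ := Set.mem_iUnion₂.1 hu
  obtain ⟨b, hb, hv⟩ := Set.mem_iUnion₂.1 hv
  exact key (hs.preconnected ⟨a, ha⟩ ⟨b, hb⟩) u v hu hv

lemma IsMinorModel.eq_of_mem {f : W → Set V} (hf : H.IsMinorModel G f) {a b : W} {v : V}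
    (ha : v ∈ f a) (hb : v ∈ f b) : a = b :=
  not_imp_comm.1 (fun h => hf.2.1 h) (Set.not_disjoint_iff.2 ⟨v, ha, hb⟩)

lemma IsMinorOf.trans (hXH : X.IsMinorOf H) (hHG : H.IsMinorOf G) : X.IsMinorOf G := by
  obtain ⟨g, hg⟩ : ∃ g, X.IsMinorModel H g := hXH
  obtain ⟨f, hf⟩ : ∃ f, H.IsMinorModel G f := hHG
  refine ⟨fun x => ⋃ w ∈ g x, f w, fun x => hf.connected_biUnion (hg.1 x), ?_, ?_⟩
  · intro x y hxy
    refine Set.disjoint_left.2 fun v hx hy => ?_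
    obtain ⟨a, ha, hva⟩ := Set.mem_iUnion₂.1 hx
    obtain ⟨b, hb, hvb⟩ := Set.mem_iUnion₂.1 hy
    obtain rfl := hf.eq_of_mem hva hvb
    exact hxy (hg.eq_of_mem ha hb)
  · intro x y hxy
    obtain ⟨a, ha, b, hb, hab⟩ := hg.2.2 hxy
    obtain ⟨u, hu, v, hv, huv⟩ := hf.2.2 hab
    exact ⟨u, Set.mem_biUnion ha hu, v, Set.mem_biUnion hb hv, huv⟩

lemma isMinorOf_induce_iff {T : Set V} :
    H.IsMinorOf (G.induce T) ↔ ∃ f, H.IsMinorModel G f ∧ ∀ w, f w ⊆ T := by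
  constructor
  · rintro ⟨f, hc, hd, ha⟩
    refine ⟨fun w => (↑) '' f w, ⟨fun w => ?_, fun w w' h => ?_, fun w w' h => ?_⟩,
      fun w => by rintro _ ⟨x, _, rfl⟩; exact x.2⟩
    · exact (connected_induce_image_iff (Embedding.induce T) _).2 (hc w)
    · exact (Set.disjoint_image_iff Subtype.val_injective).2 (hd h)
    · obtain ⟨u, hu, v, hv, huv⟩ := ha h
      exact ⟨u, ⟨u, hu, rfl⟩, v, ⟨v, hv, rfl⟩, huv⟩
  · rintro ⟨f, hf, hT⟩
    refine ⟨fun w => (↑) ⁻¹' f w, fun w => ?_, fun w w' h => ?_, fun w w' h => ?_⟩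
    · rw [← connected_induce_image_iff (Embedding.induce T)]
      have : (Embedding.induce T : G.induce T ↪g G) '' ((↑) ⁻¹' f w) = f w := by
        change ((↑) : T → V) '' _ = _
        rw [Subtype.image_preimage_coe, Set.inter_eq_right.2 (hT w)]
      rw [this]
      exact hf.1 w
    · exact (hf.2.1 h).preimage _
    · obtain ⟨u, hu, v, hv, huv⟩ := hf.2.2 h
      exact ⟨⟨u, hT w hu⟩, hu, ⟨v, hT w' hv⟩, hv, huv⟩

lemma IsMinorModel.induce {f : W → Set V} (hf : H.IsMinorModel G f) {S : Set W} {T : Set V}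
    (h : ∀ w ∈ S, f w ⊆ T) : (H.induce S).IsMinorOf (G.induce T) :=
  isMinorOf_induce_iff.2 ⟨fun w => f w,
    ⟨fun w => hf.1 w, fun _ _ hne => hf.2.1 (Subtype.coe_injective.ne hne),
      fun _ _ hadj => hf.2.2 hadj⟩, fun w => h w w.2⟩

lemma isMinorOf_induce_mono {S T : Set V} (h : S ⊆ T) :
    (G.induce S).IsMinorOf (G.induce T) :=
  .of_embedding (G.induceHomOfLE h)

lemma IsMinorModel.subset_or_subset_compl {f : W → Set V} (hf : H.IsMinorModel G f) {S : Set V}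
    (hS : G.IsEdgeClosed S) (w : W) : f w ⊆ S ∨ f w ⊆ Sᶜ := by
  obtain ⟨v, hv⟩ := hf.nonempty w
  by_cases h : v ∈ S
  · exact .inl fun u hu => (hS.mem_iff (hf.reachable_of_mem hv hu)).1 h
  · exact .inr fun u hu => mt (hS.mem_iff (hf.reachable_of_mem hv hu)).2 h

lemma IsMinorModel.isEdgeClosed {f : W → Set V} (hf : H.IsMinorModel G f) {S : Set V}
    (hS : G.IsEdgeClosed S) : H.IsEdgeClosed {w | f w ⊆ S} := by
  have key : ∀ a b, H.Adj a b → f a ⊆ S → f b ⊆ S := by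
    intro a b hab ha
    obtain ⟨u, hu, v, hv, huv⟩ := hf.2.2 hab
    exact (hf.subset_or_subset_compl hS b).resolve_right fun hb => hb hv ((hS huv).1 (ha hu))
  exact fun a b hab => ⟨key a b hab, key b a hab.symm⟩

/-- A connected minor lies on one side of an edge-closed set. -/
lemma IsMinorOf.of_isEdgeClosed (hH : H.Connected) {S T : Set V} (hS : G.IsEdgeClosed S)
    (h : H.IsMinorOf (G.induce T)) :
    H.IsMinorOf (G.induce (T ∩ S)) ∨ H.IsMinorOf (G.induce (T ∩ Sᶜ)) := by
  obtain ⟨f, hf, hT⟩ := isMinorOf_induce_iff.1 h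
  obtain ⟨w⟩ := hH.nonempty
  rcases hf.subset_or_subset_compl hS w with hw | hw
  · exact .inl <| isMinorOf_induce_iff.2 ⟨f, hf, fun a => Set.subset_inter (hT a) <|
      ((hf.isEdgeClosed hS).mem_iff (hH.preconnected w a)).1 hw⟩
  · exact .inr <| isMinorOf_induce_iff.2 ⟨f, hf, fun a => Set.subset_inter (hT a) <|
      ((hf.isEdgeClosed hS.compl).mem_iff (hH.preconnected w a)).1 hw⟩

lemma IsMinorModel.exists_injective {f : W → Set V} (hf : H.IsMinorModel G f) :
    ∃ φ : W → V, Function.Injective φ ∧ ∀ w, φ w ∈ f w := by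
  choose φ hφ using hf.nonempty
  exact ⟨φ, fun a b h => hf.eq_of_mem (hφ a) (h ▸ hφ b), hφ⟩

lemma IsMinorOf.finite [Finite V] (h : H.IsMinorOf G) : Finite W :=
  have ⟨_, hf⟩ := h
  have ⟨_, hφ, _⟩ := IsMinorModel.exists_injective hf
  .of_injective _ hφ

lemma IsMinorOf.card_le [Finite V] (h : H.IsMinorOf G) : Nat.card W ≤ Nat.card V :=
  have ⟨_, hf⟩ := h
  have ⟨_, hφ, _⟩ := IsMinorModel.exists_injective hf
  Nat.card_le_card_of_injective _ hφ

lemma IsMinorOf.card_adj_le [Finite V] (h : H.IsMinorOf G) :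
    Nat.card {p : W × W // H.Adj p.1 p.2} ≤ Nat.card {p : V × V // G.Adj p.1 p.2} := by
  obtain ⟨f, hf⟩ : ∃ f, H.IsMinorModel G f := h
  choose u hu v hv huv using hf.2.2
  refine Nat.card_le_card_of_injective (fun p => ⟨(u p.2, v p.2), huv p.2⟩) ?_
  rintro ⟨⟨a, b⟩, hab⟩ ⟨⟨c, d⟩, hcd⟩ hp
  obtain ⟨h₁, h₂⟩ : u hab = u hcd ∧ v hab = v hcd :=
    Prod.ext_iff.1 (Subtype.ext_iff.1 hp)
  have hac : a = c := hf.eq_of_mem (hu hab) (h₁.symm ▸ hu hcd)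
  have hbd : b = d := hf.eq_of_mem (hv hab) (h₂.symm ▸ hv hcd)
  subst hac hbd
  rfl

/-- The minor relation is antisymmetric up to isomorphism on finite graphs. -/
lemma IsMinorOf.antisymm [Finite V] (h : H.IsMinorOf G) (h' : G.IsMinorOf H) :
    Nonempty (H ≃g G) := by
  have := h.finite
  obtain ⟨f, hf⟩ : ∃ f, H.IsMinorModel G f := h
  obtain ⟨φ, hφ, hφf⟩ := hf.exists_injective
  have hbij : Function.Bijective φ :=
    hφ.bijective_of_nat_card_le h'.card_le
  have hmem : ∀ w, ∀ v ∈ f w, v = φ w := by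
    intro w v hv
    obtain ⟨w', rfl⟩ := hbij.2 v
    rw [hf.eq_of_mem hv (hφf w')]
  have hadj : ∀ {a b}, H.Adj a b → G.Adj (φ a) (φ b) := by
    intro a b hab
    obtain ⟨u, hu, v, hv, huv⟩ := hf.2.2 hab
    rwa [← hmem a u hu, ← hmem b v hv]
  let m : {p : W × W // H.Adj p.1 p.2} → {p : V × V // G.Adj p.1 p.2} :=
    fun p => ⟨(φ p.1.1, φ p.1.2), hadj p.2⟩
  have hm : Function.Injective m := by
    rintro ⟨⟨a, b⟩, hab⟩ ⟨⟨c, d⟩, hcd⟩ hp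
    obtain ⟨h₁, h₂⟩ := Prod.ext_iff.1 (Subtype.ext_iff.1 hp)
    obtain rfl := hφ h₁
    obtain rfl := hφ h₂
    rfl
  have hm' := hm.bijective_of_nat_card_le h'.card_adj_le
  refine ⟨⟨Equiv.ofBijective φ hbij, fun {a b} => ⟨fun hab => ?_, hadj⟩⟩⟩
  obtain ⟨⟨⟨c, d⟩, hcd⟩, hp⟩ := hm'.2 ⟨(φ a, φ b), hab⟩
  obtain ⟨h₁, h₂⟩ := Prod.ext_iff.1 (Subtype.ext_iff.1 hp)
  obtain rfl := hφ h₁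
  obtain rfl := hφ h₂
  exact hcd

/-- A graph is the disjoint sum of its restrictions to an edge-closed set and its complement. -/
lemma IsEdgeClosed.nonempty_iso_sum {S : Set V} (hS : G.IsEdgeClosed S) :
    Nonempty ((G.induce S ⊕g G.induce Sᶜ) ≃g G) := by
  classical
  refine ⟨⟨Equiv.Set.sumCompl S, ?_⟩⟩
  rintro (⟨u, hu⟩ | ⟨u, hu⟩) (⟨v, hv⟩ | ⟨v, hv⟩)
  · simp
  · simpa using fun h => hv ((hS h).1 hu)
  · simpa using fun h => hu ((hS h).2 hv)
  · simp

end SimpleGraph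

lemma disjUnion_eq_sum {V W : Type} (G : SimpleGraph V) (H : SimpleGraph W) :
    disjUnion G H = G ⊕g H := by
  ext (u | u) (v | v)
  · simpa [disjUnion, G.adj_comm v u] using fun h => h.ne
  · simp [disjUnion]
  · simp [disjUnion]
  · simpa [disjUnion, H.adj_comm v u] using fun h => h.ne

lemma K5_connected : K5.Connected := connected_top

lemma K33_adj {i j : Fin 6} : K33.Adj i j ↔ (i.val < 3 ∧ 3 ≤ j.val ∨ j.val < 3 ∧ 3 ≤ i.val) := by
  simp only [K33, fromRel_adj, ne_eq, and_iff_right_iff_imp]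
  rintro (h | h) rfl <;> omega

lemma K33_connected : K33.Connected := by
  have h₀ : ∀ j : Fin 6, 3 ≤ j.val → K33.Reachable 0 j := fun j hj =>
    Adj.reachable (K33_adj.2 (.inl ⟨by decide, hj⟩))
  refine (connected_iff_exists_forall_reachable _).2 ⟨0, fun j => ?_⟩
  by_cases hj : 3 ≤ j.val
  · exact h₀ j hj
  · exact (h₀ 3 le_rfl).trans (Adj.reachable (K33_adj.2 (.inr ⟨by omega, le_rfl⟩)))

lemma K33_not_isMinorOf_K5 : ¬ K33.IsMinorOf K5 := fun h => by
  have := h.card_le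
  simp at this

lemma K5_not_isMinorOf_K33 : ¬ K5.IsMinorOf K33 := fun h => by
  have h := h.card_adj_le
  have h₁ : Nat.card {p : Fin 5 × Fin 5 // K5.Adj p.1 p.2} = 20 := by
    simp only [K5, top_adj, Nat.card_eq_fintype_card]
    decide
  have h₂ : Nat.card {p : Fin 6 × Fin 6 // K33.Adj p.1 p.2} = 18 := by
    simp only [K33_adj, Nat.card_eq_fintype_card]
    decide
  omega

section Planarity

variable {U V W : Type} {X : SimpleGraph U} {G : SimpleGraph V} {H : SimpleGraph W}

lemma IsPlanar.of_isMinorOf (hG : IsPlanar G) (h : H.IsMinorOf G) : IsPlanar H :=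
  ⟨fun h' => hG.1 (h'.trans h), fun h' => hG.2 (h'.trans h)⟩

lemma IsPlanar.of_isEdgeClosed {S T : Set V} (hS : G.IsEdgeClosed S)
    (h₁ : IsPlanar (G.induce (T ∩ S))) (h₂ : IsPlanar (G.induce (T ∩ Sᶜ))) :
    IsPlanar (G.induce T) :=
  ⟨fun h => (h.of_isEdgeClosed K5_connected hS).elim h₁.1 h₂.1,
    fun h => (h.of_isEdgeClosed K33_connected hS).elim h₁.2 h₂.2⟩

lemma isPlanar_induce_univ_iff : IsPlanar (G.induce Set.univ) ↔ IsPlanar G :=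
  ⟨fun h => h.of_isMinorOf (.of_embedding (induceUnivIso G).symm.toEmbedding),
    fun h => h.of_isMinorOf (.of_embedding (induceUnivIso G).toEmbedding)⟩

/-- A nonplanar graph all of whose nonplanar minors are isomorphic to it. -/
def IsMinimalNonplanar (K : SimpleGraph V) : Prop :=
  ¬ IsPlanar K ∧ ∀ (W : Type) (H : SimpleGraph W), H.IsMinorOf K → ¬ IsPlanar H →
    Nonempty (H ≃g K)

lemma isMinimalNonplanar_K5 : IsMinimalNonplanar K5 := by
  refine ⟨fun h => h.1 (.of_embedding .refl), fun W H hH hP => ?_⟩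
  refine hH.antisymm (by_contra fun h => hP ⟨h, fun h' => K33_not_isMinorOf_K5 (h'.trans hH)⟩)

lemma isMinimalNonplanar_K33 : IsMinimalNonplanar K33 := by
  refine ⟨fun h => h.2 (.of_embedding .refl), fun W H hH hP => ?_⟩
  refine hH.antisymm (by_contra fun h => hP ⟨fun h' => K5_not_isMinorOf_K33 (h'.trans hH), h⟩)

lemma IsMinimalNonplanar.of_iso (hG : IsMinimalNonplanar G) (e : H ≃g G) :
    IsMinimalNonplanar H := by
  refine ⟨mt (IsPlanar.of_isMinorOf · (.of_embedding e.symm.toEmbedding)) hG.1,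
    fun _ Y hY hP => ?_⟩
  obtain ⟨i⟩ := hG.2 _ Y (hY.trans (.of_embedding e.toEmbedding)) hP
  exact ⟨i.trans e.symm⟩

lemma IsMinimalNonplanar.isApex [Finite V] (hG : IsMinimalNonplanar G) : IsApex G := by
  rcases isEmpty_or_nonempty V with hV | ⟨⟨v⟩⟩
  · exact .inl ⟨fun ⟨_, hf⟩ => hV.false (IsMinorModel.nonempty hf 0).some,
      fun ⟨_, hf⟩ => hV.false (IsMinorModel.nonempty hf 0).some⟩
  · refine .inr ⟨v, by_contra fun h => ?_⟩
    obtain ⟨e⟩ := hG.2 _ _ (.of_embedding (Embedding.induce _)) h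
    exact (Finite.card_subtype_lt (p := fun u => u ≠ v) (x := v) (by simp)).ne
      (Nat.card_congr e.toEquiv)

lemma IsApex.of_isMinorOf (hG : IsApex G) (h : H.IsMinorOf G) : IsApex H := by
  rcases hG with hG | ⟨v, hG⟩
  · exact .inl (hG.of_isMinorOf h)
  obtain ⟨f, hf⟩ : ∃ f, H.IsMinorModel G f := h
  by_cases hv : ∃ w, v ∈ f w
  · obtain ⟨w, hw⟩ := hv
    refine .inr ⟨w, hG.of_isMinorOf (hf.induce fun a ha u hu => ?_)⟩
    rintro rfl
    exact ha (hf.eq_of_mem hu hw)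
  · refine .inl (isPlanar_induce_univ_iff.1 (hG.of_isMinorOf (hf.induce fun a _ u hu => ?_)))
    rintro rfl
    exact hv ⟨a, hu⟩

lemma IsApexObstruction.of_iso (hG : IsApexObstruction G) (e : H ≃g G) :
    IsApexObstruction H :=
  ⟨mt (IsApex.of_isMinorOf · (.of_embedding e.symm.toEmbedding)) hG.1, fun _ Y hY hne =>
    hG.2 _ Y (hY.trans (.of_embedding e.toEmbedding)) ⟨fun i => hne.false (i.trans e.symm)⟩⟩

lemma not_isApex_of_not_isPlanar_induce {S : Set V} (h₁ : ¬ IsPlanar (G.induce S))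
    (h₂ : ¬ IsPlanar (G.induce Sᶜ)) : ¬ IsApex G := by
  rintro (h | ⟨v, h⟩)
  · exact h₁ (h.of_isMinorOf (.of_embedding (Embedding.induce S)))
  · by_cases hv : v ∈ S
    · exact h₂ (h.of_isMinorOf (isMinorOf_induce_mono fun u hu huv => hu (huv ▸ hv)))
    · exact h₁ (h.of_isMinorOf (isMinorOf_induce_mono fun u hu huv => hv (huv ▸ hu)))

lemma isApex_of_isEdgeClosed {S : Set V} (hS : G.IsEdgeClosed S)
    (h₁ : IsPlanar (G.induce Sᶜ)) (h₂ : IsApex (G.induce S)) : IsApex G := by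
  rcases h₂ with h₂ | ⟨⟨v, hv⟩, h₂⟩
  · refine .inl (isPlanar_induce_univ_iff.1 (.of_isEdgeClosed hS ?_ ?_)) <;>
      rwa [Set.univ_inter]
  · refine .inr ⟨v, .of_isEdgeClosed hS ?_ (h₁.of_isMinorOf
      (isMinorOf_induce_mono Set.inter_subset_right))⟩
    exact h₂.of_isMinorOf (.of_embedding ⟨⟨fun u => ⟨⟨u, u.2.2⟩, fun h =>
      u.2.1 (congrArg Subtype.val h)⟩, fun _ _ h => by simpa [Subtype.ext_iff] using h⟩, .rfl⟩)

/-- Vertex sets `S` and `Sᶜ` of minimal nonplanar components make an apex obstruction. -/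
lemma isApexObstruction_of_isMinimalNonplanar [Finite V] {S : Set V} (hS : G.IsEdgeClosed S)
    (h₁ : IsMinimalNonplanar (G.induce S)) (h₂ : IsMinimalNonplanar (G.induce Sᶜ)) :
    IsApexObstruction G := by
  refine ⟨not_isApex_of_not_isPlanar_induce h₁.1 h₂.1, fun W H hH hne => ?_⟩
  obtain ⟨f, hf⟩ : ∃ f, H.IsMinorModel G f := hH
  have apex_of_minimal : ∀ {L : Set W} {T : Set V}, IsMinimalNonplanar (G.induce T) →
      (∀ w ∈ L, f w ⊆ T) → IsApex (H.induce L) := by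
    intro L T hT hL
    exact IsApex.of_isMinorOf hT.isApex (hf.induce hL)
  let L : Set W := {w | f w ⊆ S}
  have hL : H.IsEdgeClosed L := hf.isEdgeClosed hS
  have hL₁ : ∀ w ∈ L, f w ⊆ S := fun w hw => hw
  have hL₂ : ∀ w ∈ Lᶜ, f w ⊆ Sᶜ := fun w hw => (hf.subset_or_subset_compl hS w).resolve_left hw
  by_cases hp₁ : IsPlanar (H.induce L)
  · exact isApex_of_isEdgeClosed hL.compl (by rwa [compl_compl]) (apex_of_minimal h₂ hL₂)
  by_cases hp₂ : IsPlanar (H.induce Lᶜ)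
  · exact isApex_of_isEdgeClosed hL hp₂ (apex_of_minimal h₁ hL₁)
  obtain ⟨e₁⟩ := h₁.2 _ _ (hf.induce hL₁) hp₁
  obtain ⟨e₂⟩ := h₂.2 _ _ (hf.induce hL₂) hp₂
  obtain ⟨i⟩ := hL.nonempty_iso_sum
  obtain ⟨j⟩ := hS.nonempty_iso_sum
  exact (hne.false (i.symm.trans ((Iso.sumCongr e₁ e₂).trans j))).elim

lemma isApexObstruction_sum [Finite V] [Finite W] (hG : IsMinimalNonplanar G)
    (hH : IsMinimalNonplanar H) : IsApexObstruction (G ⊕g H) := by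
  let i : G ↪g G ⊕g H := Embedding.sumInl
  let j : H ↪g G ⊕g H := Embedding.sumInr
  have hij : (Set.range i)ᶜ = Set.range j := Set.compl_range_inl
  refine isApexObstruction_of_isMinimalNonplanar (S := Set.range i) ?_
    (hG.of_iso i.isoInduceRange.symm) (hij ▸ hH.of_iso j.isoInduceRange.symm)
  rintro (u | u) (v | v) <;> simp [i]

lemma sum_isMinorOf_of_compl {S : Set V} (h₁ : X.IsMinorOf (G.induce S))
    (h₂ : H.IsMinorOf (G.induce Sᶜ)) : (X ⊕g H).IsMinorOf G := by
  obtain ⟨f, hf, hfS⟩ := isMinorOf_induce_iff.1 h₁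
  obtain ⟨g, hg, hgS⟩ := isMinorOf_induce_iff.1 h₂
  have hd : ∀ a b, Disjoint (f a) (g b) := fun a b =>
    disjoint_compl_right.mono (hfS a) (hgS b)
  refine ⟨Sum.elim f g, ?_, ?_, ?_⟩
  · rintro (a | b)
    exacts [hf.1 a, hg.1 b]
  · rintro (a | a) (b | b) hab
    · exact hf.2.1 (by simpa using hab)
    · exact hd a b
    · exact (hd b a).symm
    · exact hg.2.1 (by simpa using hab)
  · rintro (a | a) (b | b) hab
    · exact hf.2.2 (by simpa using hab)
    · simp at hab
    · simp at hab
    · exact hg.2.2 (by simpa using hab)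

/-- In a disconnected obstruction, every connected minor avoids a nonplanar induced
subgraph. -/
lemma IsApexObstruction.exists_not_isPlanar_compl [Finite V] (hG : IsApexObstruction G)
    (hc : ¬ G.Connected) (hX : X.Connected) (hXG : X.IsMinorOf G) :
    ∃ S : Set V, X.IsMinorOf (G.induce S) ∧ ¬ IsPlanar (G.induce Sᶜ) := by
  obtain ⟨f, hf⟩ : ∃ f, X.IsMinorModel G f := hXG
  obtain ⟨x⟩ := hX.nonempty
  obtain ⟨v, hv⟩ := hf.nonempty x
  let S : Set V := {u | G.Reachable v u}
  have hS : G.IsEdgeClosed S := fun a b hab =>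
    ⟨fun h => h.trans hab.reachable, fun h => h.trans hab.symm.reachable⟩
  have hfx : f x ⊆ S := fun u hu => hf.reachable_of_mem hv hu
  refine ⟨S, isMinorOf_induce_iff.2 ⟨f, hf, fun y =>
    ((hf.isEdgeClosed hS).mem_iff (hX.preconnected x y)).1 hfx⟩, fun hP => ?_⟩
  refine hG.1 (isApex_of_isEdgeClosed hS hP ?_)
  refine hG.2 _ _ (.of_embedding (Embedding.induce S)) ⟨fun e => ?_⟩
  obtain ⟨u, hu⟩ : ∃ u, u ∉ S := by
    by_contra! h
    exact hc ((connected_iff_exists_forall_reachable _).2 ⟨v, h⟩)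
  exact (Finite.card_subtype_lt (p := (· ∈ S)) hu).ne (Nat.card_congr e.toEquiv)

/-- An obstruction with minimal nonplanar minors on complementary vertex sets is their sum. -/
lemma IsApexObstruction.iso_sum (hG : IsApexObstruction G) {S : Set V}
    (hX : IsMinimalNonplanar X) (hH : IsMinimalNonplanar H) [Finite U] [Finite W]
    (h₁ : X.IsMinorOf (G.induce S)) (h₂ : H.IsMinorOf (G.induce Sᶜ)) :
    Nonempty (G ≃g X ⊕g H) := by
  by_contra hne
  exact (isApexObstruction_sum hX hH).1 <| hG.2 _ _ (sum_isMinorOf_of_compl h₁ h₂)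
    ⟨fun e => hne ⟨e.symm⟩⟩

end Planarity

/-- The disconnected apex obstructions are exactly `2K₅`, `2K_{3,3}` and `K₅ + K_{3,3}`. -/
theorem disconnected_apex_obstructions {V : Type} [Fintype V] (G : SimpleGraph V) :
    (IsApexObstruction G ∧ ¬ G.Connected) ↔
      (Nonempty (G ≃g disjUnion K5 K5) ∨ Nonempty (G ≃g disjUnion K33 K33) ∨
        Nonempty (G ≃g disjUnion K5 K33)) := by
  simp only [disjUnion_eq_sum]
  constructor
  · rintro ⟨hG, hc⟩
    have isMinorOf_or : ∀ {W : Type} {H : SimpleGraph W}, ¬ IsPlanar H →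
        K5.IsMinorOf H ∨ K33.IsMinorOf H := fun h => by
      rwa [IsPlanar, ← not_or, not_not] at h
    rcases isMinorOf_or fun h => hG.1 (.inl h) with h | h
    · obtain ⟨S, h₁, h₂⟩ := hG.exists_not_isPlanar_compl hc K5_connected h
      rcases isMinorOf_or h₂ with h₂ | h₂
      · exact .inl (hG.iso_sum isMinimalNonplanar_K5 isMinimalNonplanar_K5 h₁ h₂)
      · exact .inr (.inr (hG.iso_sum isMinimalNonplanar_K5 isMinimalNonplanar_K33 h₁ h₂))
    · obtain ⟨S, h₁, h₂⟩ := hG.exists_not_isPlanar_compl hc K33_connected h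
      rcases isMinorOf_or h₂ with h₂ | h₂
      · exact .inr (.inr ((hG.iso_sum isMinimalNonplanar_K33 isMinimalNonplanar_K5 h₁ h₂).map
          fun e => e.trans Iso.sumComm))
      · exact .inr (.inl (hG.iso_sum isMinimalNonplanar_K33 isMinimalNonplanar_K33 h₁ h₂))
  · rintro (⟨⟨e⟩⟩ | ⟨⟨e⟩⟩ | ⟨⟨e⟩⟩)
    · exact ⟨(isApexObstruction_sum isMinimalNonplanar_K5 isMinimalNonplanar_K5).of_iso e,
        mt e.connected_iff.1 not_connected_sum⟩
    · exact ⟨(isApexObstruction_sum isMinimalNonplanar_K33 isMinimalNonplanar_K33).of_iso e,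
        mt e.connected_iff.1 not_connected_sum⟩
    · exact ⟨(isApexObstruction_sum isMinimalNonplanar_K5 isMinimalNonplanar_K33).of_iso e,
        mt e.connected_iff.1 not_connected_sum⟩
end

section
/- Every connected graph in F has vertex connectivity at least 2. -/
open SimpleGraph

/-- An injective homomorphism exhibits its source as a minor of its target. -/
theorem SimpleGraph.Hom.isMinorOf {W V : Type} {H : SimpleGraph W} {G : SimpleGraph V}
    (φ : H →g G) (hφ : Function.Injective φ) : H.IsMinorOf G := by
  refine ⟨fun w => {φ w}, fun w => ?_, fun w w' hne => ?_, fun w w' hadj => ?_⟩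
  · have : Subsingleton ↥({φ w} : Set V) := Set.subsingleton_singleton.coe_sort
    exact ⟨Preconnected.of_subsingleton⟩
  · exact Set.disjoint_singleton.2 (hφ.ne hne)
  · exact ⟨φ w, rfl, φ w', rfl, φ.map_adj hadj⟩

/-- The image of a connected induced subgraph under a map that sends every edge to an edge or
to a single vertex is connected. -/
theorem SimpleGraph.induce_image_connected {V V' : Type} {G : SimpleGraph V}
    {G' : SimpleGraph V'} {s : Set V} (φ : V → V')
    (hφ : ∀ x ∈ s, ∀ y ∈ s, G.Adj x y → φ x = φ y ∨ G'.Adj (φ x) (φ y))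
    (hs : (G.induce s).Connected) : (G'.induce (φ '' s)).Connected := by
  have hreach : ∀ x y : s, (G.induce s).Reachable x y →
      (G'.induce (φ '' s)).Reachable ⟨φ x, x, x.2, rfl⟩ ⟨φ y, y, y.2, rfl⟩ := by
    rintro x y ⟨p⟩
    induction p with
    | nil => exact Reachable.refl _
    | @cons a b c hab p ih =>
      refine Reachable.trans ?_ ih
      rcases hφ a a.2 b b.2 hab with h | h
      · have : (⟨φ a, a, a.2, rfl⟩ : ↥(φ '' s)) = ⟨φ b, b, b.2, rfl⟩ := Subtype.ext h
        rw [this]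
      · exact Adj.reachable (G := G'.induce (φ '' s)) h
  obtain ⟨z⟩ := hs.nonempty
  have : Nonempty ↥(φ '' s) := ⟨⟨φ z, z, z.2, rfl⟩⟩
  refine ⟨?_⟩
  rintro ⟨_, x, hx, rfl⟩ ⟨_, y, hy, rfl⟩
  exact hreach ⟨x, hx⟩ ⟨y, hy⟩ (hs.preconnected _ _)

/-- Minors are inherited along injective homomorphisms. -/
theorem SimpleGraph.IsMinorOf.of_hom {W V V' : Type} {H : SimpleGraph W} {G : SimpleGraph V}
    {G' : SimpleGraph V'} (h : H.IsMinorOf G) (φ : G →g G') (hφ : Function.Injective φ) :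
    H.IsMinorOf G' := by
  obtain ⟨f, hconn, hdisj, hadj⟩ := h
  refine ⟨fun w => φ '' f w, fun w => ?_, fun w w' hne => ?_, fun w w' hww' => ?_⟩
  · exact induce_image_connected φ (fun _ _ _ _ h => Or.inr (φ.map_adj h)) (hconn w)
  · exact (Set.disjoint_image_iff hφ).2 (hdisj hne)
  · obtain ⟨u, hu, v, hv, huv⟩ := hadj hww'
    exact ⟨φ u, ⟨u, hu, rfl⟩, φ v, ⟨v, hv, rfl⟩, φ.map_adj huv⟩

/-- A minor of an induced subgraph can be described by branch sets in the ambient graph. -/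
theorem SimpleGraph.isMinorOf_induce_iff_s3 {W V : Type} {H : SimpleGraph W} {G : SimpleGraph V}
    {U : Set V} : H.IsMinorOf (G.induce U) ↔ ∃ f : W → Set V,
      (∀ w, f w ⊆ U) ∧ (∀ w, (G.induce (f w)).Connected) ∧
      (Pairwise fun w w' => Disjoint (f w) (f w')) ∧
      (∀ ⦃w w'⦄, H.Adj w w' → ∃ u ∈ f w, ∃ v ∈ f w', G.Adj u v) := by
  constructor
  · rintro ⟨f, hconn, hdisj, hadj⟩
    refine ⟨fun w => Subtype.val '' f w, fun w => ?_, fun w => ?_, fun w w' hne => ?_,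
      fun w w' hww' => ?_⟩
    · exact Subtype.coe_image_subset U (f w)
    · exact induce_image_connected _ (fun _ _ _ _ h => Or.inr h) (hconn w)
    · exact (Set.disjoint_image_iff Subtype.val_injective).2 (hdisj hne)
    · obtain ⟨u, hu, v, hv, huv⟩ := hadj hww'
      exact ⟨u, ⟨u, hu, rfl⟩, v, ⟨v, hv, rfl⟩, huv⟩
  · rintro ⟨f, hsub, hconn, hdisj, hadj⟩
    refine ⟨fun w => Subtype.val ⁻¹' f w, fun w => ?_, fun w w' hne => ?_, fun w w' hww' => ?_⟩
    · obtain ⟨z⟩ := (hconn w).nonempty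
      have hU : ∀ x ∈ f w, x ∈ U := hsub w
      have := (hconn w).map
        (f := (⟨fun x => ⟨⟨x, hU x x.2⟩, x.2⟩, fun h => h⟩ :
          G.induce (f w) →g (G.induce U).induce (Subtype.val ⁻¹' f w)))
        (by rintro ⟨⟨x, hx⟩, hx'⟩; exact ⟨⟨x, hx'⟩, rfl⟩)
      exact this
    · exact (hdisj hne).preimage _
    · obtain ⟨u, hu, v, hv, huv⟩ := hadj hww'
      exact ⟨⟨u, hsub _ hu⟩, hu, ⟨v, hsub _ hv⟩, hv, huv⟩

/-- `A` and `B` form a separation of `G` of order one at the vertex `v`. -/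
structure SeparatesAt {V : Type} (G : SimpleGraph V) (A B : Set V) (v : V) : Prop where
  mem_or : ∀ x, x ∈ A ∨ x ∈ B
  inter : A ∩ B = {v}
  not_adj : ∀ x ∈ A, ∀ y ∈ B, x ≠ v → y ≠ v → ¬ G.Adj x y

theorem SeparatesAt.symm {V : Type} {G : SimpleGraph V} {A B : Set V} {v : V}
    (h : SeparatesAt G A B v) : SeparatesAt G B A v where
  mem_or x := (h.mem_or x).symm
  inter := by rw [Set.inter_comm, h.inter]
  not_adj x hx y hy hxv hyv hxy := h.not_adj y hy x hx hyv hxv hxy.symm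

/-- A connected set avoiding the cut vertex that meets one side is contained in it. -/
theorem SeparatesAt.subset_of_connected {V : Type} {G : SimpleGraph V} {A B : Set V} {v : V}
    (h : SeparatesAt G A B v) {s : Set V} (hs : (G.induce s).Connected) (hv : v ∉ s)
    {x : V} (hx : x ∈ s) (hxA : x ∈ A) : s ⊆ A := by
  have hreach : ∀ a b : s, (G.induce s).Reachable a b → (a : V) ∈ A → (b : V) ∈ A := by
    rintro a b ⟨p⟩
    induction p with
    | nil => exact id
    | @cons a b c hab p ih =>
      intro ha
      refine ih ((h.mem_or b).resolve_right fun hb => ?_)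
      exact h.not_adj a ha b hb (fun e => hv (e ▸ a.2)) (fun e => hv (e ▸ b.2)) hab
  exact fun y hy => hreach ⟨x, hx⟩ ⟨y, hy⟩ (hs.preconnected _ _) hxA

/-- If every branch set avoiding the cut vertex lies in `A`, the minor model can be retracted
onto `A`. -/
theorem SeparatesAt.isMinorOf_side {W V : Type} {K : SimpleGraph W} {G : SimpleGraph V}
    {A B U : Set V} {v : V} (h : SeparatesAt G A B v) {f : W → Set V}
    (hsub : ∀ w, f w ⊆ U) (hconn : ∀ w, (G.induce (f w)).Connected)
    (hdisj : Pairwise fun w w' => Disjoint (f w) (f w'))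
    (hadj : ∀ ⦃w w'⦄, K.Adj w w' → ∃ u ∈ f w, ∃ v ∈ f w', G.Adj u v)
    (hA : ∀ w, v ∉ f w → f w ⊆ A) : K.IsMinorOf (G.induce (U ∩ A)) := by
  classical
  have hvA : v ∈ A ∧ v ∈ B := by
    have : v ∈ A ∩ B := by rw [h.inter]; rfl
    exact this
  let r : V → V := fun x => if x ∈ A then x else v
  have hrA : ∀ x, r x ∈ A := fun x => by
    by_cases hx : x ∈ A
    · simp [r, hx]
    · simp [r, hx, hvA.1]
  have hadj_r : ∀ x y, G.Adj x y → r x = r y ∨ G.Adj (r x) (r y) := by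
    have key : ∀ x y, x ∈ A → y ∉ A → G.Adj x y → x = v := by
      intro x y hx hy hxy
      by_contra hxv
      exact h.not_adj x hx y ((h.mem_or y).resolve_left hy) hxv
        (fun e => hy (e ▸ hvA.1)) hxy
    intro x y hxy
    by_cases hx : x ∈ A <;> by_cases hy : y ∈ A
    · simp [r, hx, hy, hxy]
    · simp [r, hy, key x y hx hy hxy]
    · simp [r, hx, key y x hy hx hxy.symm]
    · simp [r, hx, hy]
  have hrf : ∀ w, r '' f w ⊆ f w := by
    rintro w _ ⟨x, hx, rfl⟩
    by_cases hxA : x ∈ A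
    · simpa [r, hxA] using hx
    · have : v ∈ f w := by
        by_contra hv
        exact hxA (hA w hv hx)
      simpa [r, hxA] using this
  refine isMinorOf_induce_iff_s3.2 ⟨fun w => r '' f w, fun w => ?_, fun w => ?_,
    fun w w' hne => (hdisj hne).mono (hrf w) (hrf w'), fun w w' hww' => ?_⟩
  · refine Set.subset_inter ((hrf w).trans (hsub w)) ?_
    rintro _ ⟨x, -, rfl⟩
    exact hrA x
  · exact induce_image_connected r (fun x _ y _ hxy => hadj_r x y hxy) (hconn w)
  · obtain ⟨x, hx, y, hy, hxy⟩ := hadj hww'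
    refine ⟨r x, ⟨x, hx, rfl⟩, r y, ⟨y, hy, rfl⟩, (hadj_r x y hxy).resolve_left fun e => ?_⟩
    exact Set.disjoint_left.1 (hdisj hww'.ne) (hrf w ⟨x, hx, rfl⟩)
      (e ▸ hrf w' ⟨y, hy, rfl⟩)

/-- A graph in which any two distinct vertices are adjacent, or have a common neighbour other
than a prescribed vertex, cannot be split as a minor by a cut vertex. -/
theorem SeparatesAt.isMinorOf_or {W V : Type} {K : SimpleGraph W} {G : SimpleGraph V}
    {A B U : Set V} {v : V} (h : SeparatesAt G A B v) [Nonempty W]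
    (hK : ∀ w₀ a b : W, a ≠ b → K.Adj a b ∨ ∃ c, c ≠ w₀ ∧ K.Adj a c ∧ K.Adj c b)
    (hm : K.IsMinorOf (G.induce U)) :
    K.IsMinorOf (G.induce (U ∩ A)) ∨ K.IsMinorOf (G.induce (U ∩ B)) := by
  obtain ⟨f, hsub, hconn, hdisj, hadj⟩ := isMinorOf_induce_iff_s3.1 hm
  obtain ⟨w₀, hw₀⟩ : ∃ w₀, ∀ w, w ≠ w₀ → v ∉ f w := by
    by_cases hv : ∃ w, v ∈ f w
    · obtain ⟨w₀, hw₀⟩ := hv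
      exact ⟨w₀, fun w hne hw => Set.disjoint_left.1 (hdisj hne) hw hw₀⟩
    · push Not at hv
      exact ⟨Classical.arbitrary W, fun w _ => hv w⟩
  have side : ∀ w, v ∉ f w → f w ⊆ A ∨ f w ⊆ B := by
    intro w hw
    obtain ⟨x, hx⟩ := (hconn w).nonempty
    rcases h.mem_or x with hxA | hxB
    · exact Or.inl (h.subset_of_connected (hconn w) hw hx hxA)
    · exact Or.inr (h.symm.subset_of_connected (hconn w) hw hx hxB)
  have not_across : ∀ a b, v ∉ f a → v ∉ f b → f a ⊆ A → f b ⊆ B → ¬ K.Adj a b := by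
    intro a b ha hb haA hbB hab
    obtain ⟨x, hx, y, hy, hxy⟩ := hadj hab
    exact h.not_adj x (haA hx) y (hbB hy) (fun e => ha (e ▸ hx)) (fun e => hb (e ▸ hy)) hxy
  by_cases hall : ∀ w, v ∉ f w → f w ⊆ A
  · exact Or.inl (h.isMinorOf_side hsub hconn hdisj hadj hall)
  · right
    push Not at hall
    obtain ⟨b, hb, hbA⟩ := hall
    have hbB := (side b hb).resolve_left hbA
    refine h.symm.isMinorOf_side hsub hconn hdisj hadj fun a ha => ?_
    refine (side a ha).resolve_left fun haA => ?_
    have hne : a ≠ b := fun e => hbA (e ▸ haA)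
    rcases hK w₀ a b hne with hab | ⟨c, hc, hac, hcb⟩
    · exact not_across a b ha hb haA hbB hab
    · rcases side c (hw₀ c hc) with hcA | hcB
      · exact not_across c b (hw₀ c hc) hb hcA hbB hcb
      · exact not_across a c ha (hw₀ c hc) haA hcB hac

theorem K5_adj_or_common_neighbor (w₀ a b : Fin 5) (hab : a ≠ b) :
    K5.Adj a b ∨ ∃ c, c ≠ w₀ ∧ K5.Adj a c ∧ K5.Adj c b :=
  Or.inl hab

theorem K33_adj_or_common_neighbor (w₀ a b : Fin 6) (hab : a ≠ b) :
    K33.Adj a b ∨ ∃ c, c ≠ w₀ ∧ K33.Adj a c ∧ K33.Adj c b := by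
  revert w₀ a b
  simp only [K33, fromRel_adj]
  decide

/-- Nonplanarity is inherited along injective homomorphisms. -/
theorem not_isPlanar_of_hom {V V' : Type} {G : SimpleGraph V} {G' : SimpleGraph V'}
    (h : ¬ IsPlanar G) (φ : G →g G') (hφ : Function.Injective φ) : ¬ IsPlanar G' :=
  fun h' => h ⟨fun hm => h'.1 (hm.of_hom φ hφ), fun hm => h'.2 (hm.of_hom φ hφ)⟩

theorem not_isPlanar_induce_mono {V : Type} {G : SimpleGraph V} {A B : Set V} (hAB : A ⊆ B)
    (h : ¬ IsPlanar (G.induce A)) : ¬ IsPlanar (G.induce B) :=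
  not_isPlanar_of_hom h (induceHomOfLE G hAB).toHom (induceHomOfLE G hAB).injective

/-- A nonplanar graph with a separation of order one is nonplanar on one of the sides. -/
theorem SeparatesAt.not_isPlanar_or {V : Type} {G : SimpleGraph V} {A B U : Set V} {v : V}
    (h : SeparatesAt G A B v) (hU : ¬ IsPlanar (G.induce U)) :
    ¬ IsPlanar (G.induce (U ∩ A)) ∨ ¬ IsPlanar (G.induce (U ∩ B)) := by
  by_contra! hcon
  refine hU ⟨fun hm => ?_, fun hm => ?_⟩
  · exact (h.isMinorOf_or K5_adj_or_common_neighbor hm).elim hcon.1.1 hcon.2.1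
  · exact (h.isMinorOf_or K33_adj_or_common_neighbor hm).elim hcon.1.2 hcon.2.2

/-- In a connected apex obstruction with a separation of order one whose other side is
nontrivial, deleting the cut vertex leaves a planar graph on each side. -/
theorem IsApexObstruction.isPlanar_side {V : Type} [Finite V] {G : SimpleGraph V}
    (hG : IsApexObstruction G) (hconn : G.Connected) {A B : Set V} {v : V}
    (h : SeparatesAt G A B v) (hB : ∃ d ∈ B, d ≠ v) :
    IsPlanar (G.induce ({u | u ≠ v} ∩ A)) := by
  classical
  have := Fintype.ofFinite V
  by_contra hC
  obtain ⟨hnp, hmin⟩ := hG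
  have hdel : ∀ x, ¬ IsPlanar (G.induce {u | u ≠ x}) := fun x hx => hnp (Or.inr ⟨x, hx⟩)
  have hvAB : v ∈ A ∩ B := by rw [h.inter]; rfl
  have hdisj : ∀ x, x ∈ A → x ∈ B → x = v := fun x hxA hxB => by
    have : x ∈ A ∩ B := ⟨hxA, hxB⟩
    rwa [h.inter] at this
  by_cases hBp : IsPlanar (G.induce B)
  · obtain ⟨d, hdB, hdv⟩ := hB
    have hapex : IsApex (G.induce A) := by
      refine hmin _ _ (Hom.isMinorOf (Embedding.induce A).toHom
        Subtype.val_injective) ⟨fun e => ?_⟩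
      obtain ⟨x, hx⟩ := (Finite.injective_iff_surjective.1
        (Subtype.val_injective.comp e.symm.injective : Function.Injective
          fun x : V => ((e.symm x : A) : V))) d
      exact hdv (hdisj d (hx ▸ (e.symm x).2) hdB)
    have hsub : ∀ a : A, ¬ IsPlanar (G.induce ({u | u ≠ (a : V)} ∩ A)) := by
      intro a
      by_cases hav : (a : V) = v
      · rwa [hav]
      · refine (h.not_isPlanar_or (hdel a)).resolve_right fun hn => ?_
        exact not_isPlanar_induce_mono Set.inter_subset_right hn hBp
    rcases hapex with hp | ⟨a, ha⟩
    · exact not_isPlanar_induce_mono Set.inter_subset_right hC hp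
    · refine not_isPlanar_of_hom (hsub a) (G' := (G.induce A).induce {u | u ≠ a})
        ⟨fun x => ⟨⟨x, x.2.2⟩, fun e => x.2.1 (congrArg Subtype.val e)⟩, fun h => h⟩ ?_ ha
      intro x y hxy
      exact Subtype.ext (congrArg (fun z : ↥{u : A | u ≠ a} => ((z : A) : V)) hxy)
  · let H : SimpleGraph V :=
      { Adj := fun x y => G.Adj x y ∧ (x ∈ B ↔ y ∈ B)
        symm := ⟨fun x y hxy => ⟨hxy.1.symm, hxy.2.symm⟩⟩
        loopless := ⟨fun x hx => G.loopless.irrefl x hx.1⟩ }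
    have hHG : H ≤ G := fun x y hxy => hxy.1
    have hCB : ∀ x, x ∈ ({u | u ≠ v} ∩ A : Set V) → x ∉ B := fun x hx hxB =>
      hx.1 (hdisj x hx.2 hxB)
    have hne : H ≠ G := by
      intro e
      have hreach : ∀ x y, G.Reachable x y → x ∈ B → y ∈ B := by
        rintro x y ⟨p⟩
        induction p with
        | nil => exact id
        | @cons a b c hab p ih =>
          intro ha
          rw [← e] at hab
          exact ih (hab.2.1 ha)
      have hempty : IsEmpty ↥({u | u ≠ v} ∩ A : Set V) :=
        ⟨fun x => hCB x x.2 (hreach v x (hconn.preconnected _ _) hvAB.2)⟩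
      refine hC ⟨?_, ?_⟩
      · rintro ⟨f, hf, -⟩
        obtain ⟨z⟩ := (hf 0).nonempty
        exact hempty.false z.1
      · rintro ⟨f, hf, -⟩
        obtain ⟨z⟩ := (hf 0).nonempty
        exact hempty.false z.1
    have hHB : ∀ S : Set V, (∀ x ∈ S, x ∈ B) ∨ (∀ x ∈ S, x ∉ B) →
        ¬ IsPlanar (G.induce S) → ∀ a ∉ S, ¬ IsPlanar (H.induce {u | u ≠ a}) := by
      intro S hS hSp a ha
      refine not_isPlanar_of_hom hSp
        ⟨fun x => ⟨x, fun e => ha (e ▸ x.2)⟩, fun {x y} hxy => ⟨hxy, ?_⟩⟩ ?_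
      · rcases hS with hS | hS
        · exact iff_of_true (hS x x.2) (hS y y.2)
        · exact iff_of_false (hS x x.2) (hS y y.2)
      · intro x y hxy
        exact Subtype.ext (congrArg (fun z : ↥{u | u ≠ a} => (z : V)) hxy)
    have hHdel : ∀ a, ¬ IsPlanar (H.induce {u | u ≠ a}) := by
      intro a
      by_cases haB : a ∈ B
      · exact hHB _ (Or.inr hCB) hC a fun ha => hCB a ha haB
      · exact hHB B (Or.inl fun _ => id) hBp a haB
    have hapex : IsApex H := by
      refine hmin V H (Hom.isMinorOf (Hom.ofLE hHG) Function.injective_id) ⟨fun e => ?_⟩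
      have hlt : H.edgeFinset.card < G.edgeFinset.card :=
        Finset.card_lt_card (edgeFinset_ssubset_edgeFinset.2 (lt_of_le_of_ne hHG hne))
      exact hlt.ne e.card_edgeFinset_eq
    rcases hapex with hp | ⟨a, ha⟩
    · exact not_isPlanar_of_hom (hHdel v) (Embedding.induce _).toHom
        Subtype.val_injective hp
    · exact hHdel a ha

/-- A connected apex obstruction has no cut vertex. -/
theorem IsApexObstruction.connected_induce_ne {V : Type} [Finite V] {G : SimpleGraph V}
    (hG : IsApexObstruction G) (hconn : G.Connected) (v : V) :
    (G.induce {u | u ≠ v}).Connected := by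
  have hv : ¬ IsPlanar (G.induce {u | u ≠ v}) := fun hp => hG.1 (Or.inr ⟨v, hp⟩)
  have hne : Nonempty ↥{u | u ≠ v} := by
    by_contra hempty
    refine hv ⟨?_, ?_⟩
    · rintro ⟨f, hf, -⟩
      obtain ⟨z⟩ := (hf 0).nonempty
      exact hempty ⟨z.1⟩
    · rintro ⟨f, hf, -⟩
      obtain ⟨z⟩ := (hf 0).nonempty
      exact hempty ⟨z.1⟩
  refine ⟨fun x y => ?_⟩
  by_contra hxy
  let C : Set V := {z | ∃ hz : z ≠ v, (G.induce {u | u ≠ v}).Reachable x ⟨z, hz⟩}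
  have hvC : v ∉ C := fun h => h.1 rfl
  have hsep : SeparatesAt G (insert v C) Cᶜ v := by
    refine ⟨fun z => ?_, ?_, ?_⟩
    · by_cases hz : z ∈ C
      · exact Or.inl (Or.inr hz)
      · exact Or.inr hz
    · ext z
      simp only [Set.mem_inter_iff, Set.mem_insert_iff, Set.mem_compl_iff,
        Set.mem_singleton_iff]
      constructor
      · rintro ⟨hz | hz, hz'⟩
        · exact hz
        · exact absurd hz hz'
      · rintro rfl
        exact ⟨Or.inl rfl, hvC⟩
    · rintro a ha b hb hav hbv hab
      obtain ⟨ha', hreach⟩ := ha.resolve_left hav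
      have hab' : (G.induce {u | u ≠ v}).Adj ⟨a, hav⟩ ⟨b, hbv⟩ := hab
      exact hb ⟨hbv, hreach.trans hab'.reachable⟩
  rcases hsep.not_isPlanar_or hv with h | h
  · exact h (hG.isPlanar_side hconn hsep ⟨y, fun hy => hxy hy.2, y.2⟩)
  · exact h (hG.isPlanar_side hconn hsep.symm
      ⟨x, Or.inr ⟨x.2, Reachable.refl _⟩, x.2⟩)

/-- Every connected apex obstruction has vertex connectivity at least two. -/
theorem connected_apexObstruction_two_connected {V : Type} [Fintype V] (G : SimpleGraph V)
    (hG : IsApexObstruction G) (hconn : G.Connected) : 2 ≤ vConn G := by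
  refine le_csSup ⟨Fintype.card V, fun k hk => ?_⟩ fun s hs => ?_
  · by_contra! hlt
    obtain ⟨x⟩ := (hk Finset.univ hlt).nonempty
    exact x.2 (by simp)
  · rcases Nat.lt_succ_iff_lt_or_eq.1 hs with h | h
    · obtain rfl := Finset.card_eq_zero.1 (Nat.lt_one_iff.1 h)
      rw [Finset.coe_empty, Set.compl_empty]
      exact (induceUnivIso G).connected_iff.2 hconn
    · obtain ⟨v, rfl⟩ := Finset.card_eq_one.1 h
      rw [Finset.coe_singleton]
      exact hG.connected_induce_ne hconn v
end

section
/- If G ∈ F is connected and S is a 2-cut of G, then G − S has exactly two components. -/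
open SimpleGraph

theorem SimpleGraph.Connected.of_surjective_collapse {α β : Type} {X : SimpleGraph α}
    {Y : SimpleGraph β} (hX : X.Connected) (r : α → β) (hr : Function.Surjective r)
    (h : ∀ x y, X.Adj x y → r x = r y ∨ Y.Adj (r x) (r y)) : Y.Connected := by
  have key : ∀ x y, X.Walk x y → Y.Reachable (r x) (r y) := by
    intro x y p
    induction p with
    | nil => exact Reachable.refl _
    | cons hadj _ ih =>
      rcases h _ _ hadj with h' | h'
      · rw [h']; exact ih
      · exact h'.reachable.trans ih
  have := hX.nonempty.map r
  refine ⟨fun u v => ?_⟩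
  obtain ⟨x, rfl⟩ := hr u
  obtain ⟨y, rfl⟩ := hr v
  obtain ⟨p⟩ := hX.preconnected x y
  exact key x y p

theorem SimpleGraph.Preconnected.mem_of_closed {α : Type} {X : SimpleGraph α}
    (hX : X.Preconnected) (A : Set α) (hA : ∀ x ∈ A, ∀ y, X.Adj x y → y ∈ A)
    {x : α} (hx : x ∈ A) (y : α) : y ∈ A := by
  obtain ⟨p⟩ := hX x y
  induction p with
  | nil => exact hx
  | cons h _ ih => exact ih (hA _ hx _ h)

theorem subset_of_induce_connected {V : Type} {X : SimpleGraph V} {F A : Set V}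
    (hF : (X.induce F).Connected) (hA : ∀ x ∈ F, x ∈ A → ∀ y ∈ F, X.Adj x y → y ∈ A)
    {x : V} (hxF : x ∈ F) (hxA : x ∈ A) : F ⊆ A := fun y hy =>
  hF.preconnected.mem_of_closed {z : F | (z : V) ∈ A}
    (fun z hz w hzw => hA z z.2 hz w w.2 hzw) (x := ⟨x, hxF⟩) hxA ⟨y, hy⟩

/-- `H` is a minor of `X`, with all branch sets contained in `A`. -/
def IsMinorWithin {W V : Type} (H : SimpleGraph W) (X : SimpleGraph V) (A : Set V) : Prop :=
  ∃ f : W → Set V,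
    (∀ w, f w ⊆ A) ∧
    (∀ w, (X.induce (f w)).Connected) ∧
    (Pairwise fun w w' => Disjoint (f w) (f w')) ∧
    (∀ ⦃w w'⦄, H.Adj w w' → ∃ u ∈ f w, ∃ v ∈ f w', X.Adj u v)

theorem IsMinorWithin.mono {W V : Type} {H : SimpleGraph W} {X Y : SimpleGraph V} {A B : Set V}
    (h : IsMinorWithin H X A) (hXY : X ≤ Y) (hAB : A ⊆ B) : IsMinorWithin H Y B := by
  obtain ⟨f, h1, h2, h3, h4⟩ := h
  refine ⟨f, fun w => (h1 w).trans hAB, fun w => (h2 w).mono ?_, h3, fun w w' hw => ?_⟩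
  · intro x y hxy
    exact hXY hxy
  · obtain ⟨u, hu, v, hv, huv⟩ := h4 hw
    exact ⟨u, hu, v, hv, hXY huv⟩

theorem SimpleGraph.IsMinorOf.minorWithin {W U V : Type} {H : SimpleGraph W} {Z : SimpleGraph U}
    {X : SimpleGraph V} (h : H.IsMinorOf Z) (e : Z ↪g X) {B : Set V} (he : ∀ u, e u ∈ B) :
    IsMinorWithin H X B := by
  obtain ⟨f, h2, h3, h4⟩ := h
  refine ⟨fun w => e '' f w, ?_, fun w => ?_, ?_, ?_⟩
  · rintro w _ ⟨u, -, rfl⟩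
    exact he u
  · refine (h2 w).of_surjective_collapse (fun x => ⟨e x, x, x.2, rfl⟩) ?_ ?_
    · rintro ⟨_, u, hu, rfl⟩
      exact ⟨⟨u, hu⟩, rfl⟩
    · intro x y hxy
      exact Or.inr (e.map_adj_iff.2 hxy)
  · intro w w' hw
    exact (Set.disjoint_image_iff e.injective).2 (h3 hw)
  · intro w w' hw
    obtain ⟨u, hu, v, hv, huv⟩ := h4 hw
    exact ⟨e u, ⟨u, hu, rfl⟩, e v, ⟨v, hv, rfl⟩, e.map_adj_iff.2 huv⟩

theorem IsMinorWithin.isMinorOf {W U V : Type} {H : SimpleGraph W} {Z : SimpleGraph U}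
    {X : SimpleGraph V} {B : Set V} (h : IsMinorWithin H X B) (e : Z ↪g X)
    (he : B ⊆ Set.range e) : H.IsMinorOf Z := by
  obtain ⟨f, h1, h2, h3, h4⟩ := h
  refine ⟨fun w => e ⁻¹' f w, fun w => ?_, ?_, ?_⟩
  · have hg : ∀ x : f w, ∃ u, e u = x := fun x => he (h1 w x.2)
    choose g hg using hg
    refine (h2 w).of_surjective_collapse
      (fun x => ⟨g x, by rw [Set.mem_preimage, hg]; exact x.2⟩) ?_ ?_
    · rintro ⟨u, hu⟩
      exact ⟨⟨e u, hu⟩, Subtype.ext (e.injective (hg _))⟩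
    · intro x y hxy
      have hxy' : X.Adj (e (g x)) (e (g y)) := by
        rw [hg, hg]
        exact hxy
      exact Or.inr (e.map_adj_iff.1 hxy')
  · intro w w' hw
    exact (h3 hw).preimage e
  · intro w w' hw
    obtain ⟨u, hu, v, hv, huv⟩ := h4 hw
    obtain ⟨u, rfl⟩ := he (h1 w hu)
    obtain ⟨v, rfl⟩ := he (h1 w' hv)
    exact ⟨u, hu, v, hv, e.map_adj_iff.1 huv⟩

/-- Deleting at most two vertices leaves a graph of diameter at most two in which every vertex,
deleted or not, has a neighbour. -/
def IsTwoResilient {W : Type} (K : SimpleGraph W) : Prop :=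
  ∀ s t : W, (∀ v, ∃ u, u ≠ s ∧ u ≠ t ∧ K.Adj v u) ∧
    ∀ v w, v ≠ s → v ≠ t → w ≠ s → w ≠ t →
      v = w ∨ K.Adj v w ∨ ∃ u, u ≠ s ∧ u ≠ t ∧ K.Adj v u ∧ K.Adj u w

theorem K5_isTwoResilient : IsTwoResilient K5 := by
  intro s t
  refine ⟨fun v => ?_, fun v w _ _ _ _ => ?_⟩
  · have other : ∀ s t v : Fin 5, ∃ u, u ≠ s ∧ u ≠ t ∧ v ≠ u := by decide
    exact other s t v
  · by_cases h : v = w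
    · exact Or.inl h
    · exact Or.inr (Or.inl h)

theorem K33_isTwoResilient : IsTwoResilient K33 := by
  intro s t
  have low : ∀ s t : Fin 6, ∃ u : Fin 6, u ≠ s ∧ u ≠ t ∧ u.val < 3 := by decide
  have high : ∀ s t : Fin 6, ∃ u : Fin 6, u ≠ s ∧ u ≠ t ∧ 3 ≤ u.val := by decide
  have adj : ∀ x y : Fin 6, x.val < 3 → 3 ≤ y.val → K33.Adj x y := by
    intro x y hx hy
    rw [K33, fromRel_adj]
    exact ⟨by rintro rfl; omega, Or.inl ⟨hx, hy⟩⟩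
  obtain ⟨l, hls, hlt, hl⟩ := low s t
  obtain ⟨m, hms, hmt, hm⟩ := high s t
  refine ⟨fun v => ?_, fun v w hvs hvt hws hwt => ?_⟩
  · rcases lt_or_ge v.val 3 with hv | hv
    · exact ⟨m, hms, hmt, adj v m hv hm⟩
    · exact ⟨l, hls, hlt, (adj l v hl hv).symm⟩
  · rcases lt_or_ge v.val 3 with hv | hv <;> rcases lt_or_ge w.val 3 with hw | hw
    · exact Or.inr (Or.inr ⟨m, hms, hmt, adj v m hv hm, (adj w m hw hm).symm⟩)
    · exact Or.inr (Or.inl (adj v w hv hw))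
    · exact Or.inr (Or.inl (adj w v hw hv).symm)
    · exact Or.inr (Or.inr ⟨l, hls, hlt, (adj l v hl hv).symm, adj l w hl hw⟩)

/-- If the branch sets avoiding the clique `S` lie in the side `P` of a separation, the model can
be pushed into `P ∪ S`. -/
theorem minorWithin_of_model_side {W V : Type} {K : SimpleGraph W} {X Y : SimpleGraph V}
    {P Q S : Set V} (hXY : X ≤ Y) (hS : ∀ x ∈ S, ∀ y ∈ S, x ≠ y → Y.Adj x y)
    (hPQ : ∀ x ∈ P, ∀ y ∈ Q, ¬ X.Adj x y) (f : W → Set V)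
    (h1 : ∀ w, f w ⊆ P ∪ Q ∪ S) (h2 : ∀ w, (X.induce (f w)).Connected)
    (h3 : Pairwise fun w w' => Disjoint (f w) (f w'))
    (h4 : ∀ ⦃w w'⦄, K.Adj w w' → ∃ u ∈ f w, ∃ v ∈ f w', X.Adj u v)
    (hside : ∀ w, (∀ x ∈ f w, x ∉ S) → f w ⊆ P) : IsMinorWithin K Y (P ∪ S) := by
  classical
  have hex : ∀ w, ∀ x : V, ∃ y, x ∈ f w → y ∈ f w ∧ y ∈ P ∪ S ∧ (x ∈ P ∪ S → y = x) ∧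
      (x ∉ P ∪ S → y ∈ S) := by
    intro w x
    by_cases hx : x ∈ P ∪ S
    · exact ⟨x, fun h => ⟨h, hx, fun _ => rfl, fun h' => absurd hx h'⟩⟩
    · by_cases hw : ∀ x ∈ f w, x ∉ S
      · exact ⟨x, fun h => absurd (Or.inl (hside w hw h)) hx⟩
      · push Not at hw
        obtain ⟨y, hy, hyS⟩ := hw
        exact ⟨y, fun _ => ⟨hy, Or.inr hyS, fun h => absurd h hx, fun _ => hyS⟩⟩
  choose r hr using hex
  have hedge : ∀ w w' u v, u ∈ f w → v ∈ f w' → X.Adj u v →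
      r w u = r w' v ∨ Y.Adj (r w u) (r w' v) := by
    intro w w' u v hu hv huv
    have toS : ∀ {x y w₁ w₂}, x ∈ f w₁ → y ∈ f w₂ → X.Adj x y → x ∉ P ∪ S →
        r w₂ y ∈ S := by
      intro x y w₁ w₂ hx hy hxy hxn
      by_cases hyn : y ∈ P ∪ S
      · rw [(hr w₂ y hy).2.2.1 hyn]
        rcases hyn with hyP | hyS
        · refine absurd hxy.symm (hPQ y hyP x ?_)
          rcases h1 w₁ hx with (h | h) | h
          · exact absurd (Or.inl h) hxn
          · exact h
          · exact absurd (Or.inr h) hxn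
        · exact hyS
      · exact (hr w₂ y hy).2.2.2 hyn
    by_cases heq : r w u = r w' v
    · exact Or.inl heq
    · right
      by_cases hun : u ∈ P ∪ S
      · by_cases hvn : v ∈ P ∪ S
        · rw [(hr w u hu).2.2.1 hun, (hr w' v hv).2.2.1 hvn]
          exact hXY huv
        · exact hS _ (toS hv hu huv.symm hvn) _ ((hr w' v hv).2.2.2 hvn) heq
      · exact hS _ ((hr w u hu).2.2.2 hun) _ (toS hu hv huv hun) heq
  refine ⟨fun w => f w ∩ (P ∪ S), fun w => Set.inter_subset_right, fun w => ?_, ?_, ?_⟩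
  · refine (h2 w).of_surjective_collapse
      (fun x => ⟨r w x, (hr w x x.2).1, (hr w x x.2).2.1⟩) ?_ ?_
    · rintro ⟨x, hx, hx'⟩
      exact ⟨⟨x, hx⟩, Subtype.ext ((hr w x hx).2.2.1 hx')⟩
    · intro x y hxy
      rcases hedge w w x y x.2 y.2 hxy with h | h
      · exact Or.inl (Subtype.ext h)
      · exact Or.inr h
  · intro w w' hw
    exact (h3 hw).mono Set.inter_subset_left Set.inter_subset_left
  · intro w w' hw
    obtain ⟨u, hu, v, hv, huv⟩ := h4 hw
    have hu' := hr w u hu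
    have hv' := hr w' v hv
    refine ⟨r w u, ⟨hu'.1, hu'.2.1⟩, r w' v, ⟨hv'.1, hv'.2.1⟩, ?_⟩
    refine (hedge w w' u v hu hv huv).resolve_left fun h => ?_
    exact Set.disjoint_left.1 (h3 hw.ne) hu'.1 (h ▸ hv'.1)

theorem IsMinorWithin.split {W V : Type} {K : SimpleGraph W} (hK : IsTwoResilient K)
    {X Y : SimpleGraph V} {P Q S : Set V} {a b : V} (hab : S ⊆ {a, b})
    (hXY : X ≤ Y) (hS : ∀ x ∈ S, ∀ y ∈ S, x ≠ y → Y.Adj x y)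
    (hPQ : ∀ x ∈ P, ∀ y ∈ Q, ¬ X.Adj x y) (h : IsMinorWithin K X (P ∪ Q ∪ S)) :
    IsMinorWithin K Y (P ∪ S) ∨ IsMinorWithin K Y (Q ∪ S) := by
  obtain ⟨f, h1, h2, h3, h4⟩ := h
  rcases isEmpty_or_nonempty W with hW | ⟨⟨w₀⟩⟩
  · exact Or.inl (minorWithin_of_model_side hXY hS hPQ f h1 h2 h3 h4 fun w => hW.elim w)
  have uniq : ∀ x : V, ∃ s : W, ∀ w, w ≠ s → x ∉ f w := by
    intro x
    by_cases hx : ∃ s, x ∈ f s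
    · obtain ⟨s, hs⟩ := hx
      exact ⟨s, fun w hw hxw => Set.disjoint_left.1 (h3 hw) hxw hs⟩
    · push Not at hx
      exact ⟨w₀, fun w _ => hx w⟩
  obtain ⟨s, hs⟩ := uniq a
  obtain ⟨t, ht⟩ := uniq b
  have avoid : ∀ w, w ≠ s → w ≠ t → ∀ x ∈ f w, x ∉ S := by
    intro w hws hwt x hx hxS
    rcases hab hxS with rfl | hxb
    · exact hs w hws hx
    · rw [Set.mem_singleton_iff] at hxb
      exact ht w hwt (hxb ▸ hx)
  obtain ⟨hnbr, hconn⟩ := hK s t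
  obtain ⟨w₁, hw₁s, hw₁t, -⟩ := hnbr w₀
  have main : ∀ P Q : Set V, (∀ x ∈ P, ∀ y ∈ Q, ¬ X.Adj x y) → (∀ w, f w ⊆ P ∪ Q ∪ S) →
      (∃ x ∈ f w₁, x ∈ P) → IsMinorWithin K Y (P ∪ S) := by
    rintro P Q hPQ h1 ⟨x₁, hx₁, hx₁P⟩
    have side : ∀ w, (∀ x ∈ f w, x ∉ S) → (∃ x ∈ f w, x ∈ P) → f w ⊆ P := by
      rintro w hw ⟨x, hx, hxP⟩
      refine subset_of_induce_connected (h2 w) ?_ hx hxP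
      intro y _ hyP z hz hyz
      rcases h1 w hz with (h | h) | h
      · exact h
      · exact absurd hyz (hPQ y hyP z h)
      · exact absurd h (hw z hz)
    have step : ∀ w w', (∀ x ∈ f w', x ∉ S) → K.Adj w w' → f w ⊆ P → f w' ⊆ P := by
      intro w w' hw' hadj hP
      obtain ⟨u, hu, v, hv, huv⟩ := h4 hadj
      refine side w' hw' ⟨v, hv, ?_⟩
      rcases h1 w' hv with (h | h) | h
      · exact h
      · exact absurd huv (hPQ u (hP hu) v h)
      · exact absurd h (hw' v hv)
    have first := side w₁ (avoid w₁ hw₁s hw₁t) ⟨x₁, hx₁, hx₁P⟩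
    have all : ∀ w, w ≠ s → w ≠ t → f w ⊆ P := by
      intro w hws hwt
      rcases hconn w₁ w hw₁s hw₁t hws hwt with rfl | h | ⟨u, hus, hut, h, h'⟩
      · exact first
      · exact step w₁ w (avoid w hws hwt) h first
      · exact step u w (avoid w hws hwt) h' (step w₁ u (avoid u hus hut) h first)
    refine minorWithin_of_model_side hXY hS hPQ f h1 h2 h3 h4 fun w hw => ?_
    obtain ⟨v, hvs, hvt, hwv⟩ := hnbr w
    exact step v w hw hwv.symm (all v hvs hvt)
  obtain ⟨x₁, hx₁⟩ := (h2 w₁).nonempty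
  rcases h1 w₁ hx₁ with (h | h) | h
  · exact Or.inl (main P Q hPQ h1 ⟨x₁, hx₁, h⟩)
  · refine Or.inr (main Q P (fun x hx y hy hxy => hPQ y hy x hx hxy.symm) ?_ ⟨x₁, hx₁, h⟩)
    intro w
    rw [Set.union_comm Q P]
    exact h1 w
  · exact absurd h (avoid w₁ hw₁s hw₁t x₁ hx₁)

/-- `X` has a `K₅` or `K_{3,3}` minor inside the vertex set `A`. -/
def IsNonplanarWithin {V : Type} (X : SimpleGraph V) (A : Set V) : Prop :=
  IsMinorWithin K5 X A ∨ IsMinorWithin K33 X A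

theorem IsNonplanarWithin.mono {V : Type} {X Y : SimpleGraph V} {A B : Set V}
    (h : IsNonplanarWithin X A) (hXY : X ≤ Y) (hAB : A ⊆ B) : IsNonplanarWithin Y B :=
  h.imp (fun h => h.mono hXY hAB) fun h => h.mono hXY hAB

theorem IsNonplanarWithin.nonempty {V : Type} {X : SimpleGraph V} {A : Set V}
    (h : IsNonplanarWithin X A) : A.Nonempty := by
  rcases h with ⟨f, h1, h2, -⟩ | ⟨f, h1, h2, -⟩ <;>
  · obtain ⟨x, hx⟩ := (h2 0).nonempty
    exact ⟨x, h1 0 hx⟩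

theorem IsNonplanarWithin.split {V : Type} {X Y : SimpleGraph V} {P Q S : Set V} {a b : V}
    (hab : S ⊆ {a, b}) (hXY : X ≤ Y) (hS : ∀ x ∈ S, ∀ y ∈ S, x ≠ y → Y.Adj x y)
    (hPQ : ∀ x ∈ P, ∀ y ∈ Q, ¬ X.Adj x y) (h : IsNonplanarWithin X (P ∪ Q ∪ S)) :
    IsNonplanarWithin Y (P ∪ S) ∨ IsNonplanarWithin Y (Q ∪ S) := by
  rcases h with h | h
  · exact (h.split K5_isTwoResilient hab hXY hS hPQ).imp Or.inl Or.inl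
  · exact (h.split K33_isTwoResilient hab hXY hS hPQ).imp Or.inr Or.inr

theorem IsNonplanarWithin.split_singleton {V : Type} {X : SimpleGraph V} {P Q : Set V} {b : V}
    (hPQ : ∀ x ∈ P, ∀ y ∈ Q, ¬ X.Adj x y) (h : IsNonplanarWithin X (P ∪ Q ∪ {b})) :
    IsNonplanarWithin X (P ∪ {b}) ∨ IsNonplanarWithin X (Q ∪ {b}) :=
  h.split (a := b) (b := b) (by simp) le_rfl
    (fun x hx y hy hxy => absurd (hx.trans hy.symm) hxy) hPQ

theorem not_isPlanar_induce {V : Type} {X : SimpleGraph V} {A : Set V}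
    (h : ¬ IsPlanar (X.induce A)) : IsNonplanarWithin X A := by
  rw [IsPlanar, not_and_or, not_not, not_not] at h
  exact h.imp (fun h => h.minorWithin (Embedding.induce A) Subtype.prop)
    fun h => h.minorWithin (Embedding.induce A) Subtype.prop

theorem nonplanarWithin_of_not_isApex {V : Type} {G : SimpleGraph V} (h : ¬ IsApex G) (v : V) :
    IsNonplanarWithin G {v}ᶜ :=
  not_isPlanar_induce fun hp => h (Or.inr ⟨v, hp⟩)

theorem IsNonplanarWithin.not_isPlanar {U V : Type} {Z : SimpleGraph U} {X : SimpleGraph V}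
    {B : Set V} (h : IsNonplanarWithin X B) (e : Z ↪g X) (he : B ⊆ Set.range e) :
    ¬ IsPlanar Z := fun hp =>
  h.elim (fun h => hp.1 (h.isMinorOf e he)) fun h => hp.2 (h.isMinorOf e he)

theorem exists_planar_deletion_of_isApex_induce {V : Type} {X : SimpleGraph V} {A : Set V}
    (hne : A.Nonempty) (h : IsApex (X.induce A)) :
    ∃ v ∈ A, ¬ IsNonplanarWithin X (A \ {v}) := by
  rcases h with h | ⟨v, h⟩
  · obtain ⟨v, hv⟩ := hne
    refine ⟨v, hv, fun hN => hN.not_isPlanar (Embedding.induce A) ?_ h⟩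
    rintro x ⟨hx, -⟩
    exact ⟨⟨x, hx⟩, rfl⟩
  · refine ⟨v, v.2, fun hN => hN.not_isPlanar
      ((Embedding.induce A).comp (Embedding.induce {u | u ≠ v})) ?_ h⟩
    rintro x ⟨hx, hxv⟩
    exact ⟨⟨⟨x, hx⟩, fun h => hxv (congrArg Subtype.val h)⟩, rfl⟩

theorem isMinorOf_induce_of_le {V : Type} {X G : SimpleGraph V} (h : X ≤ G) (A : Set V) :
    (X.induce A).IsMinorOf G := by
  refine ⟨fun w => {(w : V)}, fun w => ?_, fun w w' hw => ?_, fun w w' hw => ?_⟩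
  · have : Unique ({(w : V)} : Set V) := Set.uniqueSingleton _
    exact ⟨Preconnected.of_subsingleton⟩
  · exact Set.disjoint_singleton.2 fun h => hw (Subtype.ext h)
  · exact ⟨w, rfl, w', rfl, h hw⟩

theorem isEmpty_iso_induce {V : Type} [Finite V] {X G : SimpleGraph V} {A : Set V}
    (hA : A ≠ Set.univ) : IsEmpty (X.induce A ≃g G) := by
  refine ⟨fun e => hA ?_⟩
  refine Set.eq_of_subset_of_ncard_le (Set.subset_univ A) ?_
  rw [Set.ncard_univ]
  exact (Nat.card_congr e.toEquiv).ge

theorem IsApexObstruction.exists_planar_deletion {V : Type} [Finite V] {X G : SimpleGraph V}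
    (hG : IsApexObstruction G) {A : Set V} (hne : A.Nonempty) (hA : A ≠ Set.univ)
    (hm : (X.induce A).IsMinorOf G) : ∃ v ∈ A, ¬ IsNonplanarWithin X (A \ {v}) :=
  exists_planar_deletion_of_isApex_induce hne (hG.2 _ _ hm (isEmpty_iso_induce hA))

theorem IsApexObstruction.not_disjoint_nonplanar {V : Type} {G : SimpleGraph V}
    (hG : IsApexObstruction G) (hconn : G.Connected) {A B : Set V} (hAB : Disjoint A B)
    (hA : IsNonplanarWithin G A) (hB : IsNonplanarWithin G B) : False := by
  let X : SimpleGraph V :=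
    { Adj := fun x y => G.Adj x y ∧ (x ∈ A ∧ y ∈ A ∨ x ∈ B ∧ y ∈ B)
      symm := ⟨fun x y h => ⟨h.1.symm, h.2.imp And.symm And.symm⟩⟩
      loopless := ⟨fun x h => G.loopless.irrefl x h.1⟩ }
  have hXG : X ≤ G := fun x y h => h.1
  have keep : ∀ C : Set V, (C = A ∨ C = B) → IsNonplanarWithin G C → IsNonplanarWithin X C := by
    intro C hC h
    have aux : ∀ {W : Type} {K : SimpleGraph W}, IsMinorWithin K G C → IsMinorWithin K X C := by
      rintro W K ⟨f, h1, h2, h3, h4⟩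
      have hadj : ∀ x ∈ C, ∀ y ∈ C, G.Adj x y → X.Adj x y := by
        intro x hx y hy hxy
        rcases hC with rfl | rfl
        · exact ⟨hxy, Or.inl ⟨hx, hy⟩⟩
        · exact ⟨hxy, Or.inr ⟨hx, hy⟩⟩
      refine ⟨f, h1, fun w => (h2 w).mono ?_, h3, fun w w' hw => ?_⟩
      · intro x y hxy
        exact hadj x (h1 w x.2) y (h1 w y.2) hxy
      · obtain ⟨u, hu, v, hv, huv⟩ := h4 hw
        exact ⟨u, hu, v, hv, hadj u (h1 w hu) v (h1 w' hv) huv⟩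
    exact h.imp aux aux
  obtain ⟨x, hx⟩ := hA.nonempty
  obtain ⟨y, hy⟩ := hB.nonempty
  have hempty : IsEmpty (X.induce Set.univ ≃g G) := by
    refine ⟨fun e => ?_⟩
    have hX : (X.induce Set.univ).Preconnected := e.connected_iff.2 hconn |>.preconnected
    have : y ∈ A := hX.mem_of_closed {z : Set.univ (α := V) | (z : V) ∈ A} (by
      rintro z hz w ⟨-, hzw | hzw⟩
      · exact hzw.2
      · exact absurd hzw.1 (Set.disjoint_left.1 hAB hz)) (x := ⟨x, trivial⟩) hx ⟨y, trivial⟩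
    exact Set.disjoint_left.1 hAB this hy
  obtain ⟨v, -, hv⟩ := exists_planar_deletion_of_isApex_induce ⟨x, Set.mem_univ x⟩
    (hG.2 _ _ (isMinorOf_induce_of_le hXG Set.univ) hempty)
  by_cases hvA : v ∈ A
  · exact hv ((keep B (Or.inr rfl) hB).mono le_rfl fun z hz =>
      ⟨trivial, fun h => Set.disjoint_left.1 hAB hvA (h ▸ hz)⟩)
  · exact hv ((keep A (Or.inl rfl) hA).mono le_rfl fun z hz => ⟨trivial, fun h => hvA (h ▸ hz)⟩)

/-- A connected obstruction has no cut vertex. -/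
theorem IsApexObstruction.no_cut_vertex {V : Type} [Finite V] {G : SimpleGraph V}
    (hG : IsApexObstruction G) (hconn : G.Connected) {P : Set V} {b : V} (hne : P.Nonempty)
    (hb : b ∉ P) (hP : ∀ x ∈ P, ∀ y, G.Adj x y → y ∈ P ∪ {b}) : P ∪ {b} = Set.univ := by
  have main : ∀ P Q : Set V, P.Nonempty → Q.Nonempty → Disjoint P Q → b ∉ P → b ∉ Q →
      P ∪ Q ∪ {b} = Set.univ → (∀ x ∈ P, ∀ y ∈ Q, ¬ G.Adj x y) → IsNonplanarWithin G P →
      False := by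
    rintro P Q hPne ⟨q, hq⟩ hdisj hbP hbQ huniv hPQ hN
    have hQ : ¬ IsNonplanarWithin G (Q ∪ {b}) := by
      refine hG.not_disjoint_nonplanar hconn ?_ hN
      exact Set.disjoint_union_right.2 ⟨hdisj, Set.disjoint_singleton_right.2 hbP⟩
    obtain ⟨v, hv, hvN⟩ := hG.exists_planar_deletion (X := G) (A := P ∪ {b})
      (hPne.mono Set.subset_union_left) (by
        intro h
        rcases (h ▸ Set.mem_univ q : q ∈ P ∪ {b}) with h | h
        · exact Set.disjoint_left.1 hdisj h hq
        · exact hbQ (h ▸ hq)) (isMinorOf_induce_of_le le_rfl _)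
    rcases hv with hv | rfl
    · have hvb : v ≠ b := fun h => hbP (h ▸ hv)
      have h := (nonplanarWithin_of_not_isApex hG.1 v).mono le_rfl
        (B := (P \ {v}) ∪ Q ∪ {b}) (by
          intro x hx
          rcases (huniv ▸ Set.mem_univ x : x ∈ P ∪ Q ∪ {b}) with (h | h) | h
          · exact Or.inl (Or.inl ⟨h, hx⟩)
          · exact Or.inl (Or.inr h)
          · exact Or.inr h)
      rcases h.split_singleton (fun x hx y hy => hPQ x hx.1 y hy) with h | h
      · refine hvN (h.mono le_rfl ?_)
        rintro x (hx | rfl)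
        · exact ⟨Or.inl hx.1, hx.2⟩
        · exact ⟨Or.inr rfl, fun h => hvb h.symm⟩
      · exact hQ h
    · exact hvN (hN.mono le_rfl fun x hx => ⟨Or.inl hx, fun h => hbP (h ▸ hx)⟩)
  by_contra hne'
  obtain ⟨q, hq⟩ := (Set.ne_univ_iff_exists_notMem _).1 hne'
  set Q := (P ∪ {b})ᶜ with hQdef
  have hdisj : Disjoint P Q := by
    rw [Set.disjoint_left]
    exact fun x hx hx' => hx' (Or.inl hx)
  have hbQ : b ∉ Q := fun h => h (Or.inr rfl)
  have huniv : P ∪ Q ∪ {b} = Set.univ := by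
    rw [Set.union_right_comm]
    exact Set.union_compl_self _
  have hPQ : ∀ x ∈ P, ∀ y ∈ Q, ¬ G.Adj x y := fun x hx y hy hxy => hy (hP x hx y hxy)
  have hN := (nonplanarWithin_of_not_isApex hG.1 b).mono le_rfl (B := P ∪ Q ∪ ∅) (by
    intro x hx
    rcases (huniv ▸ Set.mem_univ x : x ∈ P ∪ Q ∪ {b}) with h | h
    · exact Or.inl h
    · exact absurd h hx)
  have hsplit := hN.split (Y := G) (a := b) (b := b) (Set.empty_subset _) le_rfl (by simp) hPQ
  rw [Set.union_empty, Set.union_empty] at hsplit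
  rcases hsplit with h | h
  · exact main P Q hne ⟨q, hq⟩ hdisj hb hbQ huniv hPQ h
  · exact main Q P ⟨q, hq⟩ hne hdisj.symm hbQ hb (by rwa [Set.union_comm Q P])
      (fun x hx y hy hxy => hPQ y hy x hx hxy.symm) h

/-- Contracting a part `Q` of `G - {a, b}` onto `a` creates the edge `ab`. -/
theorem IsApexObstruction.isMinorOf_contract {V : Type} [Finite V] {G : SimpleGraph V}
    (hG : IsApexObstruction G) (hconn : G.Connected) {Q : Set V} {a b : V} (hab : a ≠ b)
    (haQ : a ∉ Q) (hbQ : b ∉ Q) (hne : Q.Nonempty)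
    (hQ : ∀ x ∈ Q, ∀ y, G.Adj x y → y ∈ Q ∪ {a, b}) :
    ((G ⊔ edge a b).induce Qᶜ).IsMinorOf G := by
  classical
  let Z := G.induce (Q ∪ {a})
  let a' : ↥(Q ∪ {a}) := ⟨a, Or.inr rfl⟩
  let R : Set V := {x | ∃ h : x ∈ Q ∪ {a}, Z.Reachable a' ⟨x, h⟩}
  have haR : a ∈ R := ⟨Or.inr rfl, Reachable.refl _⟩
  have hRclosed : ∀ x ∈ R, ∀ y ∈ Q ∪ {a}, G.Adj x y → y ∈ R := by
    rintro x ⟨hx, hr⟩ y hy hxy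
    exact ⟨hy, hr.trans (Adj.reachable (G := Z) (u := ⟨x, hx⟩) (v := ⟨y, hy⟩) hxy)⟩
  have hRconn : (G.induce R).Connected := by
    refine (Z.connectedComponentMk a').connected_toSimpleGraph.of_surjective_collapse
      (fun x => ⟨x.1, x.1.2, (ConnectedComponent.exact x.2).symm⟩) ?_ fun x y hxy => Or.inr hxy
    rintro ⟨x, hx, hr⟩
    exact ⟨⟨⟨x, hx⟩, ConnectedComponent.sound hr.symm⟩, rfl⟩
  have hRb : ∃ x ∈ R, G.Adj x b := by
    by_contra hcon
    push Not at hcon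
    by_cases hRQ : (R ∩ Q).Nonempty
    · have h := hG.no_cut_vertex hconn (P := R ∩ Q) (b := a) hRQ (fun h => haQ h.2) (by
        rintro x ⟨hxR, hxQ⟩ y hxy
        rcases hQ x hxQ y hxy with h | rfl | rfl
        · exact Or.inl ⟨hRclosed x hxR y (Or.inl h) hxy, h⟩
        · exact Or.inr rfl
        · exact absurd hxy (hcon x hxR))
      rcases (h ▸ Set.mem_univ b : b ∈ R ∩ Q ∪ {a}) with h | h
      · exact hbQ h.2
      · exact hab h.symm
    · have h := hG.no_cut_vertex hconn (P := Q) (b := b) hne hbQ (by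
        intro x hxQ y hxy
        rcases hQ x hxQ y hxy with h | rfl | rfl
        · exact Or.inl h
        · exact absurd ⟨x, hRclosed y haR x (Or.inl hxQ) hxy.symm, hxQ⟩ hRQ
        · exact Or.inr rfl)
      rcases (h ▸ Set.mem_univ a : a ∈ Q ∪ {b}) with h | h
      · exact haQ h
      · exact hab h
  obtain ⟨r, hrR, hrb⟩ := hRb
  let f : ↥Qᶜ → Set V := fun w => if (w : V) = a then R else {(w : V)}
  have hself : ∀ w : ↥Qᶜ, (w : V) ∈ f w := by
    intro w
    by_cases hw : (w : V) = a
    · simp only [f, if_pos hw]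
      exact hw ▸ haR
    · simp only [f, if_neg hw]
      exact rfl
  have hRsub : ∀ x ∈ R, x ∉ Q → x = a := by
    rintro x ⟨h | h, -⟩ hx
    · exact absurd h hx
    · exact h
  have huniq : ∀ (w w' : ↥Qᶜ), ∀ x ∈ f w, x ∈ f w' → w = w' := by
    have aux : ∀ (w : ↥Qᶜ), ∀ x ∈ f w, x ∉ Q → x = w := by
      intro w x hx hxQ
      by_cases hw : (w : V) = a
      · simp only [f, if_pos hw] at hx
        rw [hw]; exact hRsub x hx hxQ
      · simp only [f, if_neg hw] at hx
        exact hx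
    have aux' : ∀ (w : ↥Qᶜ), ∀ x ∈ f w, x ∈ Q → (w : V) = a := by
      intro w x hx hxQ
      by_contra hw
      simp only [f, if_neg hw] at hx
      exact w.2 (hx ▸ hxQ)
    intro w w' x hx hx'
    by_cases hxQ : x ∈ Q
    · exact Subtype.ext ((aux' w x hx hxQ).trans (aux' w' x hx' hxQ).symm)
    · exact Subtype.ext ((aux w x hx hxQ).symm.trans (aux w' x hx' hxQ))
  have hfa : ∀ w : ↥Qᶜ, (w : V) = a → r ∈ f w := by
    intro w hw
    simp only [f, if_pos hw]
    exact hrR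
  refine ⟨f, fun w => ?_, fun w w' hw => ?_, fun w w' hw => ?_⟩
  · by_cases hw : (w : V) = a
    · have hfw : f w = R := if_pos hw
      rw [hfw]
      exact hRconn
    · have hfw : f w = {(w : V)} := if_neg hw
      rw [hfw]
      have : Unique ({(w : V)} : Set V) := Set.uniqueSingleton _
      exact ⟨Preconnected.of_subsingleton⟩
  · exact Set.disjoint_left.2 fun x hx hx' => hw (huniq w w' x hx hx')
  · rcases hw with hw | hw
    · exact ⟨w, hself w, w', hself w', hw⟩
    · change (edge a b).Adj (w : V) (w' : V) at hw
      rw [edge_adj] at hw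
      rcases hw.1 with ⟨h, h'⟩ | ⟨h, h'⟩
      · exact ⟨r, hfa w h, w', hself w', h' ▸ hrb⟩
      · exact ⟨w, hself w, r, hfa w' h', h ▸ hrb.symm⟩

/-- The vertices outside `{a, b}` of colour `i`. -/
def sideOf {V : Type} (a b : V) (c : V → Fin 3) (i : Fin 3) : Set V :=
  {x | x ≠ a ∧ x ≠ b ∧ c x = i}

theorem IsApexObstruction.not_three_sides_of_nonplanar {V : Type} [Finite V]
    {G : SimpleGraph V} (hG : IsApexObstruction G) (hconn : G.Connected) {a b : V} (hab : a ≠ b)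
    (c : V → Fin 3) (hne : ∀ i, (sideOf a b c i).Nonempty)
    (hc : ∀ x y, x ≠ a → x ≠ b → y ≠ a → y ≠ b → G.Adj x y → c x = c y) {i j k : Fin 3}
    (hij : i ≠ j) (hik : i ≠ k) (hjk : j ≠ k) (ha : IsNonplanarWithin G (sideOf a b c i ∪ {a}))
    (hb : IsNonplanarWithin G (sideOf a b c i ∪ {b})) : False := by
  have hcover : ∀ l : Fin 3, l = i ∨ l = j ∨ l = k := by grind
  set Y := G ⊔ edge a b
  have hGY : G ≤ Y := le_sup_left
  have hS : ∀ x ∈ ({a, b} : Set V), ∀ y ∈ ({a, b} : Set V), x ≠ y → Y.Adj x y := by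
    rintro x (rfl | rfl) y (rfl | rfl) hxy
    · exact absurd rfl hxy
    · exact Or.inr (by simp [edge_adj, hxy])
    · exact Or.inr (by simp [edge_adj, hxy])
    · exact absurd rfl hxy
  have hYc : ∀ x y, x ≠ a → x ≠ b → y ≠ a → y ≠ b → Y.Adj x y → c x = c y := by
    rintro x y hxa hxb hya hyb (h | h)
    · exact hc x y hxa hxb hya hyb h
    · rw [edge_adj] at h
      grind
  have hdel : ∀ Q : Set V, Q.Nonempty → a ∉ Q → b ∉ Q → (∀ x ∈ Q, c x ≠ i) →
      (∀ x ∈ Q, ∀ y, y ≠ a → y ≠ b → c x = c y → y ∈ Q) →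
      ∃ v ∈ Qᶜ, v ≠ a ∧ v ≠ b ∧ ¬ IsNonplanarWithin Y (Qᶜ \ {v}) := by
    intro Q hQ haQ hbQ hQi hQc
    have hm := hG.isMinorOf_contract hconn hab haQ hbQ hQ (by
      intro x hx y hxy
      by_cases hya : y = a
      · exact Or.inr (Or.inl hya)
      by_cases hyb : y = b
      · exact Or.inr (Or.inr hyb)
      have hxa : x ≠ a := fun h => haQ (h ▸ hx)
      have hxb : x ≠ b := fun h => hbQ (h ▸ hx)
      exact Or.inl (hQc x hx y hya hyb (hc x y hxa hxb hya hyb hxy)))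
    obtain ⟨v, hv, hvN⟩ := hG.exists_planar_deletion ⟨a, haQ⟩ (by
      intro h
      obtain ⟨q, hq⟩ := hQ
      exact (h ▸ Set.mem_univ q : q ∈ Qᶜ) hq) hm
    refine ⟨v, hv, ?_, ?_, hvN⟩
    · rintro rfl
      refine hvN (hb.mono hGY ?_)
      rintro x (⟨hx, -, hxi⟩ | rfl)
      · exact ⟨fun h => hQi x h hxi, hx⟩
      · exact ⟨hbQ, hab.symm⟩
    · rintro rfl
      refine hvN (ha.mono hGY ?_)
      rintro x (⟨-, hx, hxi⟩ | rfl)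
      · exact ⟨fun h => hQi x h hxi, hx⟩
      · exact ⟨haQ, hab⟩
  have hlast : ∀ m n : Fin 3, i ≠ m → i ≠ n → m ≠ n →
      IsNonplanarWithin Y (sideOf a b c m ∪ {a, b}) → False := by
    intro m n him hin hmn hN
    have hcov : ∀ l : Fin 3, l = i ∨ l = m ∨ l = n := by
      grind
    obtain ⟨v, hv, hva, hvb, hvN⟩ := hdel (sideOf a b c n) (hne n) (fun h => h.1 rfl)
      (fun h => h.2.1 rfl) (fun x hx h => hin (h.symm.trans hx.2.2))
      (fun x hx y hya hyb hxy => ⟨hya, hyb, hxy.symm.trans hx.2.2⟩)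
    by_cases hvi : c v = i
    · refine hvN (hN.mono le_rfl ?_)
      intro x hx
      simp only [sideOf, Set.mem_union, Set.mem_ofPred_eq, Set.mem_insert_iff, Set.mem_sdiff,
        Set.mem_compl_iff, Set.mem_singleton_iff] at hx ⊢
      grind
    · refine hvN (ha.mono hGY ?_)
      intro x hx
      simp only [sideOf, Set.mem_union, Set.mem_ofPred_eq, Set.mem_sdiff,
        Set.mem_compl_iff, Set.mem_singleton_iff] at hx ⊢
      grind
  obtain ⟨v, hv, hva, hvb, hvN⟩ := hdel (sideOf a b c j ∪ sideOf a b c k)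
    ((hne j).mono Set.subset_union_left)
    (fun h => h.elim (fun h => h.1 rfl) fun h => h.1 rfl)
    (fun h => h.elim (fun h => h.2.1 rfl) fun h => h.2.1 rfl)
    (fun x hx h => hx.elim (fun hx => hij (h.symm.trans hx.2.2))
      fun hx => hik (h.symm.trans hx.2.2))
    (fun x hx y hya hyb hxy => hx.imp (fun hx => ⟨hya, hyb, hxy.symm.trans hx.2.2⟩)
      fun hx => ⟨hya, hyb, hxy.symm.trans hx.2.2⟩)
  have hN := (nonplanarWithin_of_not_isApex hG.1 v).mono le_rfl
    (B := (sideOf a b c i \ {v}) ∪ (sideOf a b c j ∪ sideOf a b c k) ∪ {a, b}) (by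
      intro x hx
      have := hcover (c x)
      simp only [sideOf, Set.mem_union, Set.mem_ofPred_eq, Set.mem_sdiff, Set.mem_insert_iff,
        Set.mem_compl_iff, Set.mem_singleton_iff] at hx ⊢
      grind)
  have hsep : ∀ m n, m ≠ n → ∀ x ∈ sideOf a b c m, ∀ y ∈ sideOf a b c n, ¬ Y.Adj x y := by
    rintro m n hmn x ⟨hxa, hxb, rfl⟩ y ⟨hya, hyb, rfl⟩ hxy
    exact hmn (hYc x y hxa hxb hya hyb hxy)
  rcases hN.split Set.Subset.rfl hGY hS (fun x hx y hy hxy => hy.elim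
    (fun hy => hsep i j hij x hx.1 y hy (hGY hxy))
    fun hy => hsep i k hik x hx.1 y hy (hGY hxy)) with h | h
  · refine hvN (h.mono le_rfl ?_)
    intro x hx
    simp only [sideOf, Set.mem_union, Set.mem_ofPred_eq, Set.mem_sdiff, Set.mem_insert_iff,
      Set.mem_compl_iff, Set.mem_singleton_iff] at hx ⊢
    grind
  · rcases h.split Set.Subset.rfl le_rfl hS (hsep j k hjk) with h | h
    · exact hlast j k hij hik hjk h
    · exact hlast k j hik hij hjk.symm h

theorem IsApexObstruction.not_three_sides {V : Type} [Finite V] {G : SimpleGraph V}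
    (hG : IsApexObstruction G) (hconn : G.Connected) {a b : V} (hab : a ≠ b)
    (c : V → Fin 3) (hne : ∀ i, (sideOf a b c i).Nonempty)
    (hc : ∀ x y, x ≠ a → x ≠ b → y ≠ a → y ≠ b → G.Adj x y → c x = c y) : False := by
  have hsep : ∀ m n, m ≠ n → ∀ x ∈ sideOf a b c m, ∀ y ∈ sideOf a b c n, ¬ G.Adj x y := by
    rintro m n hmn x ⟨hxa, hxb, rfl⟩ y ⟨hya, hyb, rfl⟩ hxy
    exact hmn (hc x y hxa hxb hya hyb hxy)
  have hside : ∀ s t : V, (∀ x, x ≠ s → x ≠ t → x ≠ a ∧ x ≠ b) →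
      ∃ i, IsNonplanarWithin G (sideOf a b c i ∪ {t}) := by
    intro s t hst
    have hN := (nonplanarWithin_of_not_isApex hG.1 s).mono le_rfl
      (B := sideOf a b c 0 ∪ (sideOf a b c 1 ∪ sideOf a b c 2) ∪ {t}) (by
        intro x hx
        by_cases hxt : x = t
        · exact Or.inr hxt
        obtain ⟨hxa, hxb⟩ := hst x hx hxt
        have hcov : ∀ l : Fin 3, l = 0 ∨ l = 1 ∨ l = 2 := by decide
        rcases hcov (c x) with h | h | h
        · exact Or.inl (Or.inl ⟨hxa, hxb, h⟩)
        · exact Or.inl (Or.inr (Or.inl ⟨hxa, hxb, h⟩))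
        · exact Or.inl (Or.inr (Or.inr ⟨hxa, hxb, h⟩)))
    rcases hN.split_singleton (fun x hx y hy => hy.elim (hsep 0 1 (by decide) x hx y)
      (hsep 0 2 (by decide) x hx y)) with h | h
    · exact ⟨0, h⟩
    · rcases h.split_singleton (hsep 1 2 (by decide)) with h | h
      · exact ⟨1, h⟩
      · exact ⟨2, h⟩
  obtain ⟨i, hi⟩ := hside b a fun x h h' => ⟨h', h⟩
  obtain ⟨j, hj⟩ := hside a b fun x h h' => ⟨h, h'⟩
  by_cases hij : i = j
  · subst hij
    have hothers : ∀ i : Fin 3, ∃ j k, i ≠ j ∧ i ≠ k ∧ j ≠ k := by decide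
    obtain ⟨j, k, h1, h2, h3⟩ := hothers i
    exact hG.not_three_sides_of_nonplanar hconn hab c hne hc h1 h2 h3 hi hj
  · refine hG.not_disjoint_nonplanar hconn ?_ hi hj
    rw [Set.disjoint_left]
    rintro x (⟨hxa, hxb, hxi⟩ | rfl) (⟨hxa', hxb', hxj⟩ | hx)
    · exact hij (hxi.symm.trans hxj)
    · exact hxb hx
    · exact hxa' rfl
    · exact hab hx

/-- If `G` is a connected apex obstruction and `S` is a 2-cut of `G`, then `G − S`
has exactly two connected components. -/
theorem twoCut_two_components {V : Type} [Fintype V] (G : SimpleGraph V)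
    (hG : IsApexObstruction G) (hconn : G.Connected) (S : Set V) (hS : IsTwoCut G S) :
    Nat.card (G.induce Sᶜ).ConnectedComponent = 2 := by
  classical
  obtain ⟨hcard, hpre⟩ := hS
  obtain ⟨a, b, hab, rfl⟩ := Set.ncard_eq_two.1 hcard
  rw [Preconnected] at hpre
  push Not at hpre
  obtain ⟨x, y, hxy⟩ := hpre
  by_contra hne
  set Z := G.induce ({a, b} : Set V)ᶜ
  have hthird : ∃ z, ¬ Z.Reachable z x ∧ ¬ Z.Reachable z y := by
    by_contra! hcon
    refine hne (Nat.card_eq_two_iff.2 ⟨Z.connectedComponentMk x, Z.connectedComponentMk y,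
      fun h => hxy (ConnectedComponent.exact h), ?_⟩)
    rw [Set.eq_univ_iff_forall]
    intro C
    induction C using ConnectedComponent.ind with | _ z
    by_cases hzx : Z.Reachable z x
    · exact Or.inl (ConnectedComponent.sound hzx)
    · exact Or.inr (ConnectedComponent.sound (hcon z hzx))
  obtain ⟨z, hzx, hzy⟩ := hthird
  let c : V → Fin 3 := fun v =>
    if h : v ∈ ({a, b} : Set V)ᶜ then
      if Z.Reachable ⟨v, h⟩ x then 0 else if Z.Reachable ⟨v, h⟩ y then 1 else 2
    else 0
  have mem : ∀ v, v ≠ a → v ≠ b → v ∈ ({a, b} : Set V)ᶜ := by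
    rintro v hva hvb (h | h)
    · exact hva h
    · exact hvb h
  have hside : ∀ v : ↥({a, b} : Set V)ᶜ, (v : V) ∈ sideOf a b c (c v) := fun v =>
    ⟨fun h => v.2 (Or.inl h), fun h => v.2 (Or.inr h), rfl⟩
  have hcv : ∀ v : ↥({a, b} : Set V)ᶜ, c v =
      if Z.Reachable v x then 0 else if Z.Reachable v y then 1 else 2 := fun v => dif_pos v.2
  refine hG.not_three_sides hconn hab c ?_ ?_
  · intro i
    fin_cases i
    · refine ⟨x, ?_⟩
      have h := hside x
      rwa [hcv, if_pos (Reachable.refl x)] at h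
    · refine ⟨y, ?_⟩
      have h := hside y
      rwa [hcv, if_neg fun h => hxy h.symm, if_pos (Reachable.refl y)] at h
    · refine ⟨z, ?_⟩
      have h := hside z
      rwa [hcv, if_neg hzx, if_neg hzy] at h
  · intro u v hua hub hva hvb huv
    have hr : Z.Reachable ⟨u, mem u hua hub⟩ ⟨v, mem v hva hvb⟩ := Adj.reachable huv
    have key : ∀ w, Z.Reachable ⟨u, mem u hua hub⟩ w ↔ Z.Reachable ⟨v, mem v hva hvb⟩ w :=
      fun w => ⟨hr.symm.trans, hr.trans⟩
    rw [hcv ⟨u, mem u hua hub⟩, hcv ⟨v, mem v hva hvb⟩]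
    simp only [key]
end
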